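/- arXiv:1508.05277 — 3 statements merged into one kernel-verified Lean document; each statement's English description precedes it below -/
import Mathlib

section
/- Let p be a prime and (K,v) a p-henselian valued field of mixed characteristic (0,p), i.e. char(K) = 0 and char(Kv) = p, such that K contains a primitive p-th root of unity, the subring O_v[1/p] of K generated by the valuation ring O_v together with 1/p is all of K, and the group K^×/(K^×)^p is finite. If Γ_v = pΓ_v, then for every a ∈ K^× which is not a p-th power in K, the norm map N_{L/K} : L^× → K^× is surjective, where L = K(α) for α a root of X^p − a; equivalently, the maximal pro-p quotient G_K(p) = Gal(K(p)/K) is a free pro-p group (of cohomological dimension at most 1). -/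
noncomputable section

/-- The maximal `p`-extension of `K` inside an ambient field extension `Ω`:
the compositum of all finite Galois subextensions of `Ω/K` of `p`-power degree. -/
def maxPExt (p : ℕ) (K Ω : Type*) [Field K] [Field Ω] [Algebra K Ω] :
    IntermediateField K Ω :=
  ⨆ L : {L : IntermediateField K Ω //
      FiniteDimensional K ↥L ∧ IsGalois K ↥L ∧ ∃ n : ℕ, Module.finrank K ↥L = p ^ n}, L.1

/-- A valuation (subring) of `K` is `p`-henselian if it extends uniquely to `K(p)`. -/
def IsPHenselian (p : ℕ) {K : Type*} [Field K] (O : ValuationSubring K) : Prop :=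
  ∃! O' : ValuationSubring ↥(maxPExt p K (AlgebraicClosure K)),
    O'.comap (algebraMap K ↥(maxPExt p K (AlgebraicClosure K))) = O

/-- The valuation-theoretic form of `(x + y) ^ p ≡ x ^ p + y ^ p` modulo `p x y`. -/
lemma exists_add_pow_prime_eq_of_valuation_le_one {K : Type*} [Field K] {O : ValuationSubring K}
    {p : ℕ} (hp : p.Prime) {x y : K} (hx : O.valuation x ≤ 1) (hy : O.valuation y ≤ 1) :
    ∃ r, O.valuation r ≤ 1 ∧ (x + y) ^ p = x ^ p + y ^ p + p * x * y * r := by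
  obtain ⟨r, hr⟩ := exists_add_pow_prime_eq hp
    (⟨x, (O.valuation_le_one_iff x).1 hx⟩ : O) ⟨y, (O.valuation_le_one_iff y).1 hy⟩
  exact ⟨r, O.valuation_le_one r, by simpa using congrArg (Subtype.val) hr⟩

lemma valuation_natCast_le_one {K : Type*} [Field K] (O : ValuationSubring K) (n : ℕ) :
    O.valuation (n : K) ≤ 1 := by
  exact O.valuation_le_one (n : O)

/-- If `1 + S ^ p x` and `1 + (S r) ^ p x` differ by a `p`-th power, then `x` is close to
a `p`-th power. -/
lemma exists_pow_near_of_pow_mul_eq {K : Type*} [Field K] {O : ValuationSubring K}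
    {p : ℕ} (hp : p.Prime) {S r x y w : K} (hS0 : S ≠ 0) (hS : O.valuation S < 1)
    (hr : O.valuation r < 1) (hy : O.valuation y ≤ 1)
    (hx : O.valuation x ≤ O.valuation y ^ p)
    (hpS : O.valuation (p : K) ≤ O.valuation (y * S) ^ (p - 1))
    (hw : w ^ p * (1 + (S * r) ^ p * x) = 1 + S ^ p * x) :
    ∃ B, O.valuation B ≤ O.valuation y ∧
      O.valuation (1 + x - (1 + B) ^ p) * O.valuation S ^ p ≤
        O.valuation (p : K) * O.valuation y * O.valuation S := by
  set v := O.valuation with hv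
  have hp0 : p ≠ 0 := hp.ne_zero
  have hpv : v (p : K) ≤ 1 := valuation_natCast_le_one O p
  have hx1 : v x ≤ 1 := hx.trans (pow_le_one₀ zero_le hy)
  have hxy : v x ≤ v y := hx.trans (pow_le_of_le_one zero_le hy hp0)
  have key : ∀ T : K, v T < 1 → v (1 + T ^ p * x) = 1 := fun T hT ↦ by
    refine v.map_one_add_of_lt ?_
    rw [map_mul, map_pow]
    exact mul_lt_one_of_lt_of_le (pow_lt_one₀ zero_le hT hp0) hx1
  have hSr : v (S * r) < 1 := by
    rw [map_mul]; exact mul_lt_one_of_lt_of_le hS hr.le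
  have hw1 : v w = 1 := by
    have := congrArg v hw
    rw [map_mul, key _ hSr, key _ hS, mul_one, map_pow] at this
    exact (pow_eq_one_iff_of_nonneg zero_le hp0).1 this
  obtain ⟨b, rfl⟩ : ∃ b, w = 1 + b := ⟨w - 1, by ring⟩
  have hb1 : v b ≤ 1 := by
    have := v.map_sub (1 + b) 1
    simpa [hw1] using this
  obtain ⟨g, hg1, hg⟩ := exists_add_pow_prime_eq_of_valuation_le_one hp
    (O := O) (x := 1) (y := b) (by simp) hb1
  have hwr : v ((1 + b) * r) < 1 := by rw [map_mul, hw1, one_mul]; exact hr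
  set f := 1 - (1 + b) * r with hf
  have hf1 : v f = 1 := v.map_one_sub_of_lt hwr
  have hf0 : f ≠ 0 := fun h ↦ by simp [h] at hf1
  obtain ⟨h, hh1, hh⟩ := exists_add_pow_prime_eq_of_valuation_le_one hp
    (O := O) (x := f) (y := (1 + b) * r) hf1.le hwr.le
  have eq1 : S ^ p * x * (f ^ p + p * f * ((1 + b) * r) * h) = b ^ p + p * b * g := by
    have e1 : f + (1 + b) * r = 1 := by rw [hf]; ring
    rw [e1, one_pow, mul_pow] at hh
    have e2 : f ^ p + p * f * ((1 + b) * r) * h = 1 - (1 + b) ^ p * r ^ p := by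
      linear_combination -hh
    rw [e2]
    rw [mul_pow] at hw
    rw [one_pow] at hg
    linear_combination hg - hw
  have hb : v b ≤ v (y * S) := by
    by_contra! hlt
    have hb0 : v b ≠ 0 := (zero_le.trans_lt hlt).ne'
    have hpb : v (p : K) < v b ^ (p - 1) :=
      hpS.trans_lt (pow_lt_pow_left₀ hlt zero_le (Nat.sub_ne_zero_of_lt hp.one_lt))
    have e : b ^ p = S ^ p * x * (f ^ p + p * f * ((1 + b) * r) * h) - p * b * g := by
      rw [eq1]; ring
    have : v (b ^ p) < v b ^ p := by
      rw [e]
      refine v.map_sub_lt ?_ ?_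
      · have h1 : v (f ^ p + p * f * ((1 + b) * r) * h) ≤ 1 := by
          refine v.map_add_le (by simp [hf1]) ?_
          rw [map_mul, map_mul, map_mul, hf1, mul_one]
          exact mul_le_one' (mul_le_one' hpv hwr.le) hh1
        rw [map_mul, map_mul, map_pow]
        calc v S ^ p * v x * v _ ≤ v S ^ p * v y ^ p * 1 := by gcongr
          _ = v (y * S) ^ p := by rw [map_mul, mul_pow, mul_one, mul_comm]
          _ < v b ^ p := pow_lt_pow_left₀ hlt zero_le hp0
      · rw [map_mul, map_mul]
        calc v (p : K) * v b * v g ≤ v (p : K) * v b * 1 := by gcongr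
          _ = v (p : K) * v b := mul_one _
          _ < v b ^ (p - 1) * v b := mul_lt_mul_of_pos_right hpb (zero_lt_iff.2 hb0)
          _ = v b ^ p := pow_sub_one_mul hp0 _
    rw [map_pow] at this
    exact this.false
  have hvS0 : v S ≠ 0 := (v.ne_zero_iff).2 hS0
  set B := b / (S * f) with hB
  have hBv : v B ≤ v y := by
    rw [hB, map_div₀, map_mul, hf1, mul_one]
    rw [map_mul] at hb
    exact div_le_of_le_mul₀ zero_le zero_le hb
  obtain ⟨g', hg'1, hg'⟩ := exists_add_pow_prime_eq_of_valuation_le_one hp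
    (O := O) (x := 1) (y := B) (by simp) (hBv.trans hy)
  refine ⟨B, hBv, ?_⟩
  have e : (1 + x - (1 + B) ^ p) * S ^ p * f ^ p =
      p * (b * g - f * ((1 + b) * r) * h * x * S ^ p - B * g' * (S ^ p * f ^ p)) := by
    have : B ^ p * (S ^ p * f ^ p) = b ^ p := by
      rw [← mul_pow, ← mul_pow, hB]
      field_simp
    rw [hg', one_pow]
    linear_combination eq1 - this
  have e2 := congrArg v e
  rw [map_mul, map_mul, map_pow, map_pow, hf1, one_pow, mul_one] at e2
  rw [e2, map_mul, mul_assoc (v (p : K))]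
  have hSp : v S ^ p ≤ v S := pow_le_of_le_one zero_le hS.le hp0
  refine mul_le_mul_of_nonneg_left ?_ zero_le
  refine v.map_sub_le (v.map_sub_le ?_ ?_) ?_
  · rw [map_mul v y S] at hb
    rw [map_mul]
    calc v b * v g ≤ v y * v S * 1 := by gcongr
      _ = _ := mul_one _
  · rw [map_mul, map_mul, map_mul, map_mul, hf1, map_pow, one_mul]
    calc v ((1 + b) * r) * v h * v x * v S ^ p ≤ 1 * 1 * v y * v S := by gcongr
      _ = _ := by simp
  · rw [map_mul, map_mul, map_mul, map_pow, map_pow, hf1, one_pow, mul_one]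
    calc v B * v g' * v S ^ p ≤ v y * 1 * v S := by gcongr
      _ = _ := by simp

/-- Improvement step: if `m` exceeds the number of classes modulo `p`-th powers, then among the
units `1 + s ^ (i p) x` with `1 ≤ i ≤ m` two agree modulo `p`-th powers, and this moves `1 + x`
closer to `1` modulo `p`-th powers. -/
lemma exists_pow_mul_one_add_of_card_lt {K : Type*} [Field K] {O : ValuationSubring K}
    {p : ℕ} (hp : p.Prime) [Finite (Kˣ ⧸ (powMonoidHom p : Kˣ →* Kˣ).range)] {m M k : ℕ}
    (hm : Nat.card (Kˣ ⧸ (powMonoidHom p : Kˣ →* Kˣ).range) < m)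
    {s x : K} (hs0 : s ≠ 0) (hs : O.valuation s < 1)
    (hps : O.valuation (p : K) = O.valuation s ^ M)
    (hM : (k + m) * (p - 1) ≤ M) (hM' : p * m < M + m)
    (hx : O.valuation x ≤ O.valuation s ^ (k * p)) (hu : O.valuation (1 + x) = 1) :
    ∃ w x', 1 + x = w ^ p * (1 + x') ∧ O.valuation w = 1 ∧
      O.valuation x' * O.valuation s ^ (p * m) ≤ O.valuation s ^ (M + k + m) := by
  set v := O.valuation with hv
  have hp0 : p ≠ 0 := hp.ne_zero
  have hx1 : v x ≤ 1 := hx.trans (pow_le_one₀ zero_le hs.le)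
  have hs0' : 0 < v s := zero_lt_iff.2 ((v.ne_zero_iff).2 hs0)
  have key : ∀ i : ℕ, v (1 + (s ^ (i + 1)) ^ p * x) = 1 := fun i ↦ by
    refine v.map_one_add_of_lt ?_
    rw [map_mul, map_pow, map_pow]
    exact mul_lt_one_of_lt_of_le
      (pow_lt_one₀ zero_le (pow_lt_one₀ zero_le hs (by simp)) hp0) hx1
  have key0 : ∀ i : ℕ, 1 + (s ^ (i + 1)) ^ p * x ≠ 0 := fun i h ↦ by
    have := key i
    simp [h] at this
  have := Fintype.ofFinite (Kˣ ⧸ (powMonoidHom p : Kˣ →* Kˣ).range)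
  obtain ⟨i₀, j₀, hij₀, heq₀⟩ := Fintype.exists_ne_map_eq_of_card_lt
    (fun i : Fin m ↦ (QuotientGroup.mk (Units.mk0 _ (key0 i)) :
      Kˣ ⧸ (powMonoidHom p : Kˣ →* Kˣ).range)) (by simpa [Nat.card_eq_fintype_card] using hm)
  obtain ⟨i, j, hij, heq⟩ : ∃ i j : Fin m, i < j ∧
      (QuotientGroup.mk (Units.mk0 _ (key0 j)) : Kˣ ⧸ (powMonoidHom p : Kˣ →* Kˣ).range) =
        QuotientGroup.mk (Units.mk0 _ (key0 i)) := by
    rcases lt_or_gt_of_ne hij₀ with h | h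
    · exact ⟨i₀, j₀, h, heq₀.symm⟩
    · exact ⟨j₀, i₀, h, heq₀⟩
  obtain ⟨w, hw⟩ := QuotientGroup.eq.1 heq
  have hw' : (w : K) ^ p * (1 + (s ^ ((j : ℕ) + 1)) ^ p * x) =
      1 + (s ^ ((i : ℕ) + 1)) ^ p * x := by
    have := congrArg Units.val ((eq_inv_mul_iff_mul_eq).1 hw)
    simpa [mul_comm] using this
  obtain ⟨d, hd⟩ : ∃ d : ℕ, (j : ℕ) = i + 1 + d := Nat.exists_eq_add_of_le hij
  have hsplit : s ^ ((j : ℕ) + 1) = s ^ ((i : ℕ) + 1) * s ^ (d + 1) := by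
    rw [← pow_add]; congr 1; omega
  rw [hsplit] at hw'
  have him : (i : ℕ) + 1 ≤ m := i.2
  obtain ⟨B, hB, hB'⟩ := exists_pow_near_of_pow_mul_eq (O := O) hp (y := s ^ k)
    (pow_ne_zero _ hs0) (by rw [map_pow]; exact pow_lt_one₀ zero_le hs (by simp))
    (by rw [map_pow]; exact pow_lt_one₀ zero_le hs (by simp))
    (by rw [map_pow]; exact pow_le_one₀ zero_le hs.le)
    (by rwa [map_pow, ← pow_mul])
    (by
      rw [← pow_add, map_pow, ← pow_mul, hps]
      refine pow_le_pow_of_le_one zero_le hs.le (le_trans ?_ hM)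
      gcongr) hw'
  set E := 1 + x - (1 + B) ^ p with hE
  rw [← hv, hps, map_pow, map_pow, ← pow_mul] at hB'
  have hbound : v E * v s ^ (p * m) ≤ v s ^ (M + k + m) := by
    obtain ⟨e, he⟩ : ∃ e : ℕ, (i : ℕ) + 1 + e = m := ⟨m - (i + 1), Nat.add_sub_cancel' him⟩
    obtain ⟨q, rfl⟩ := Nat.exists_eq_add_of_le' hp.one_le
    calc v E * v s ^ ((q + 1) * m)
        = v E * v s ^ (((i : ℕ) + 1) * (q + 1)) * v s ^ (e * (q + 1)) := by
          rw [mul_assoc, ← pow_add, ← add_mul, he, mul_comm (q + 1)]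
      _ ≤ v s ^ M * v s ^ k * v s ^ ((i : ℕ) + 1) * v s ^ e := by
          gcongr ?_ * ?_
          exact pow_le_pow_of_le_one zero_le hs.le (Nat.le_mul_of_pos_right _ (by simp))
      _ = v s ^ (M + k + m) := by rw [← pow_add, ← pow_add, ← pow_add, add_assoc (M + k), he]
  have hE1 : v E < 1 := by
    by_contra! h
    have : v s ^ (p * m) ≤ v s ^ (M + k + m) :=
      (le_mul_of_one_le_left zero_le h).trans hbound
    rw [pow_le_pow_iff_right_of_lt_one₀ hs0' hs] at this
    omega
  have hBp : v ((1 + B) ^ p) = 1 := by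
    have : (1 + B) ^ p = (1 + x) - E := by rw [hE]; ring
    rw [this, v.map_sub_eq_of_lt_left (by rwa [hu]), hu]
  have hB1 : v (1 + B) = 1 := by
    rw [map_pow] at hBp
    exact (pow_eq_one_iff_of_nonneg zero_le hp0).1 hBp
  have hB0 : 1 + B ≠ 0 := fun h ↦ by simp [h] at hB1
  refine ⟨1 + B, E / (1 + B) ^ p, ?_, hB1, ?_⟩
  · rw [mul_add, mul_one, mul_div_cancel₀ _ (pow_ne_zero _ hB0), hE]; ring
  · rwa [map_div₀, hBp, div_one]

lemma exists_valuation_eq_pow {K : Type*} [Field K] {O : ValuationSubring K} {p : ℕ}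
    (hdiv : (powMonoidHom p : Kˣ →* Kˣ).range ⊔ O.unitGroup = ⊤) (c : Kˣ) :
    ∃ b u : Kˣ, c = b ^ p * u ∧ O.valuation (u : K) = 1 := by
  have hc : c ∈ (powMonoidHom p : Kˣ →* Kˣ).range ⊔ O.unitGroup := hdiv ▸ Subgroup.mem_top c
  obtain ⟨_, ⟨b, rfl⟩, u, hu, rfl⟩ := Subgroup.mem_sup.1 hc
  exact ⟨b, u, rfl, (O.mem_unitGroup_iff u).1 hu⟩

lemma exists_valuation_eq_pow_pow {K : Type*} [Field K] {O : ValuationSubring K} {p : ℕ}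
    (hdiv : (powMonoidHom p : Kˣ →* Kˣ).range ⊔ O.unitGroup = ⊤) (N : ℕ) (c : Kˣ) :
    ∃ s : Kˣ, O.valuation (c : K) = O.valuation (s : K) ^ p ^ N := by
  induction N with
  | zero => exact ⟨c, by simp⟩
  | succ N ih =>
    obtain ⟨s, hs⟩ := ih
    obtain ⟨b, u, rfl, hu⟩ := exists_valuation_eq_pow hdiv s
    exact ⟨b, by simp [hs, hu, pow_succ', pow_mul]⟩

/-- Every class of `Kˣ` modulo `p`-th powers has a representative `1 + x` with `v x < v p`. -/
lemma exists_pow_mul_one_add {K : Type*} [Field K] [CharZero K] {O : ValuationSubring K}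
    {p : ℕ} (hp : p.Prime) [Finite (Kˣ ⧸ (powMonoidHom p : Kˣ →* Kˣ).range)]
    (hpv : O.valuation (p : K) < 1)
    (hdiv : (powMonoidHom p : Kˣ →* Kˣ).range ⊔ O.unitGroup = ⊤) {c : K} (hc : c ≠ 0) :
    ∃ w x, c = w ^ p * (1 + x) ∧ O.valuation x < O.valuation (p : K) := by
  obtain ⟨b, u, hbu, hu⟩ := exists_valuation_eq_pow hdiv (Units.mk0 c hc)
  obtain ⟨q, hq⟩ := Nat.exists_eq_add_of_le' hp.one_le
  set m := Nat.card (Kˣ ⧸ (powMonoidHom p : Kˣ →* Kˣ).range) + 1 with hm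
  set k := q * m + 1 with hk
  set N := p * (k + m) with hN
  obtain ⟨s, hs⟩ := exists_valuation_eq_pow_pow hdiv N
    (Units.mk0 (p : K) (Nat.cast_ne_zero.2 hp.ne_zero))
  rw [Units.val_mk0] at hs
  have hNM : N < p ^ N := Nat.lt_pow_self hp.one_lt
  set M := p ^ N with hM
  have hs1 : O.valuation (s : K) < 1 := by
    by_contra! h
    exact (hs ▸ hpv).not_ge (one_le_pow₀ h)
  have hs0 : 0 < O.valuation (s : K) := zero_lt_iff.2 ((Valuation.ne_zero_iff _).2 s.ne_zero)
  have hNe : N = p * k + p * m := by rw [hN]; ring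
  have hpk : k ≤ p * k := Nat.le_mul_of_pos_left _ hp.pos
  have hMk : (k + m) * (p - 1) ≤ M := by
    refine le_trans ?_ hNM.le
    rw [hN, mul_comm p]
    exact Nat.mul_le_mul_left _ (Nat.sub_le _ _)
  have hM0 : (0 + m) * (p - 1) ≤ M :=
    (Nat.mul_le_mul_right _ (by omega)).trans hMk
  have hM' : p * m < M + m := by omega
  obtain ⟨w₁, x₁, h₁, hw₁, hx₁⟩ := exists_pow_mul_one_add_of_card_lt (O := O) hp (m := m)
    (M := M) (k := 0) (x := (u : K) - 1) (Nat.lt_succ_self _) s.ne_zero hs1 hs hM0 hM'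
    (by
      rw [zero_mul, pow_zero]
      exact O.valuation.map_sub_le hu.le (by simp)) (by simpa using hu)
  have hx₁' : O.valuation x₁ ≤ O.valuation (s : K) ^ (k * p) := by
    refine le_of_mul_le_mul_right (hx₁.trans ?_) (pow_pos hs0 (p * m))
    rw [← pow_add]
    refine pow_le_pow_of_le_one zero_le hs1.le ?_
    rw [mul_comm k]; omega
  have hu₁ : O.valuation (1 + x₁) = 1 := by
    have := congrArg O.valuation h₁
    rwa [map_mul, map_pow, hw₁, one_pow, one_mul, add_sub_cancel, hu, eq_comm] at this
  obtain ⟨w₂, x₂, h₂, hw₂, hx₂⟩ := exists_pow_mul_one_add_of_card_lt (O := O) hp (m := m)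
    (M := M) (k := k) (x := x₁) (Nat.lt_succ_self _) s.ne_zero hs1 hs hMk hM' hx₁' hu₁
  refine ⟨b * w₁ * w₂, x₂, ?_, ?_⟩
  · have hcu : c = (b : K) ^ p * u := by simpa using congrArg Units.val hbu
    rw [add_sub_cancel] at h₁
    rw [hcu, h₁, h₂]; ring
  · rw [hs]
    refine lt_of_mul_lt_mul_right (hx₂.trans_lt ?_) (zero_le (a := O.valuation (s : K) ^ (p * m)))
    rw [← pow_add]
    refine pow_lt_pow_right_of_lt_one₀ hs0 hs1 ?_
    rw [hk, hq]
    nlinarith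

lemma valuation_lt_one_iff_inv_notMem {K : Type*} [Field K] {O : ValuationSubring K} {x : K}
    (hx : x ≠ 0) : O.valuation x < 1 ↔ x⁻¹ ∉ O := by
  rw [← O.valuation_le_one_iff, map_inv₀, not_le, one_lt_inv₀]
  exact zero_lt_iff.2 ((Valuation.ne_zero_iff _).2 hx)

lemma valuation_comap_lt_one_iff {K E : Type*} [Field K] [Field E] {O : ValuationSubring K}
    {O' : ValuationSubring E} (f : K →+* E) (h : O'.comap f = O) (x : K) :
    O'.valuation (f x) < 1 ↔ O.valuation x < 1 := by
  rcases eq_or_ne x 0 with rfl | hx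
  · simp
  · rw [valuation_lt_one_iff_inv_notMem ((map_ne_zero f).2 hx),
      valuation_lt_one_iff_inv_notMem hx, ← h, ValuationSubring.mem_comap, map_inv₀]

instance normal_maxPExt (p : ℕ) (K Ω : Type*) [Field K] [Field Ω] [Algebra K Ω] :
    Normal K (maxPExt p K Ω) :=
  IntermediateField.normal_iSup (h := fun L ↦ L.2.2.1.to_normal)

open Polynomial in
lemma minpoly_eq_X_pow_sub_C {K E : Type*} [Field K] [Field E] [Algebra K E] {p : ℕ}
    (hp : p.Prime) {z : K} (hz : ∀ b : K, b ^ p ≠ z) {α : E} (hα : α ^ p = algebraMap K E z) :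
    minpoly K α = X ^ p - C z :=
  (minpoly.eq_of_irreducible_of_monic (X_pow_sub_C_irreducible_of_prime hp hz)
    (by simp [hα]) (monic_X_pow_sub_C z hp.ne_zero)).symm

lemma isIntegral_of_pow_eq_algebraMap {K E : Type*} [Field K] [Field E] [Algebra K E] {p : ℕ}
    (hp : p.Prime) {z : K} {α : E} (hα : α ^ p = algebraMap K E z) : IsIntegral K α :=
  IsIntegral.of_pow hp.pos (hα ▸ isIntegral_algebraMap)

open IntermediateField in
lemma finrank_adjoin_simple_of_pow_eq {K Ω : Type*} [Field K] [Field Ω] [Algebra K Ω] {p : ℕ}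
    (hp : p.Prime) {a : K} (hnp : ∀ b : K, b ^ p ≠ a) {α : Ω}
    (hα : α ^ p = algebraMap K Ω a) : Module.finrank K K⟮α⟯ = p := by
  rw [adjoin.finrank (isIntegral_of_pow_eq_algebraMap hp hα), minpoly_eq_X_pow_sub_C hp hnp hα,
    Polynomial.natDegree_X_pow_sub_C]

open IntermediateField in
lemma mem_maxPExt_of_pow_eq {K Ω : Type*} [Field K] [Field Ω] [Algebra K Ω] {p : ℕ}
    (hp : p.Prime) {ζ : K} (hζ : IsPrimitiveRoot ζ p) {z : K} (hz : ∀ b : K, b ^ p ≠ z)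
    {α : Ω} (hα : α ^ p = algebraMap K Ω z) : α ∈ maxPExt p K Ω := by
  have hrank : Module.finrank K K⟮α⟯ = p := finrank_adjoin_simple_of_pow_eq hp hz hα
  have hfd : FiniteDimensional K K⟮α⟯ :=
    adjoin.finiteDimensional (isIntegral_of_pow_eq_algebraMap hp hα)
  have hprim : (primitiveRoots (Module.finrank K K⟮α⟯) K).Nonempty :=
    ⟨ζ, (mem_primitiveRoots (hrank ▸ hp.pos)).2 (hrank ▸ hζ)⟩
  have hgen : (AdjoinSimple.gen K α) ^ Module.finrank K K⟮α⟯ = algebraMap K K⟮α⟯ z := by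
    rw [hrank]
    exact Subtype.ext (by simpa using hα)
  have htop : K⟮AdjoinSimple.gen K α⟯ = ⊤ :=
    lift_injective K⟮α⟯ (by rw [lift_adjoin_simple, lift_top, AdjoinSimple.coe_gen])
  have hgal : IsGalois K K⟮α⟯ := by
    have h := (isCyclic_tfae K K⟮α⟯ hprim).out 0 2
    exact (h.2 ⟨AdjoinSimple.gen K α, ⟨z, hgen.symm⟩, htop⟩).1
  exact le_iSup (fun L : {L : IntermediateField K Ω //
      FiniteDimensional K ↥L ∧ IsGalois K ↥L ∧ ∃ n : ℕ, Module.finrank K ↥L = p ^ n} ↦ L.1)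
    ⟨K⟮α⟯, hfd, hgal, 1, by rw [hrank, pow_one]⟩ (mem_adjoin_simple_self K α)

/-- In a `p`-henselian field, elements of `1 + (ζ - 1) ^ p 𝔪` are `p`-th powers. -/
lemma IsPHenselian.exists_pow_eq {K : Type*} [Field K] {O : ValuationSubring K} {p : ℕ}
    (hO : IsPHenselian p O) (hp : p.Prime) {ζ : K} (hζ : IsPrimitiveRoot ζ p) {μ : K}
    (hμ : O.valuation μ < 1) : ∃ b : K, b ^ p = 1 + (ζ - 1) ^ p * μ := by
  by_contra! hz
  set z := 1 + (ζ - 1) ^ p * μ with hzdef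
  obtain ⟨α, hα⟩ := IsAlgClosed.exists_pow_nat_eq (algebraMap K (AlgebraicClosure K) z) hp.pos
  set E := maxPExt p K (AlgebraicClosure K)
  have hαE : α ∈ E := mem_maxPExt_of_pow_eq hp hζ hz hα
  obtain ⟨A, hA⟩ : ∃ A : E, A ^ p = algebraMap K E z := ⟨(⟨α, hαE⟩ : E), Subtype.ext hα⟩
  set Z := algebraMap K E ζ with hZdef
  have hZ : IsPrimitiveRoot Z p := hζ.map_of_injective (algebraMap K E).injective
  obtain ⟨O', hO', huniq⟩ := hO
  obtain ⟨σ, hσ⟩ : ∃ σ : E ≃ₐ[K] E, σ A = Z * A := by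
    refine minpoly.exists_algEquiv_of_root'
      (isIntegral_of_pow_eq_algebraMap hp hA).isAlgebraic ?_
    rw [minpoly_eq_X_pow_sub_C hp hz hA]
    simp [mul_pow, hZ.pow_eq_one, hA]
  have hσO : O'.comap (σ : E →+* E) = O' := by
    refine huniq _ ?_
    change (O'.comap (σ : E →+* E)).comap (algebraMap K E) = O
    rw [ValuationSubring.comap_comap, ← hO']
    congr 1
    ext x
    simp
  have hπ0 : Z - 1 ≠ 0 := sub_ne_zero.2 (hZ.ne_one hp.one_lt)
  have hπ0' : O'.valuation (Z - 1) ≠ 0 := (Valuation.ne_zero_iff _).2 hπ0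
  have hμ' : O'.valuation (algebraMap K E μ) < 1 :=
    (valuation_comap_lt_one_iff (algebraMap K E) hO' μ).2 hμ
  have hprod : ∏ i ∈ Finset.range p, (1 - Z ^ i * A) = -((Z - 1) ^ p * algebraMap K E μ) := by
    have := congrArg (Polynomial.eval 1) (X_pow_sub_C_eq_prod hZ hp.pos hA)
    rw [Polynomial.eval_prod] at this
    simp only [Polynomial.eval_sub, Polynomial.eval_X, Polynomial.eval_C, Polynomial.eval_pow,
      one_pow] at this
    rw [← this, hzdef]
    simp [hZdef]
  obtain ⟨i, hi⟩ : ∃ i : ℕ, O'.valuation ((1 - Z ^ i * A) / (Z - 1)) < 1 := by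
    by_contra! h
    have hle : O'.valuation (Z - 1) ^ p ≤
        O'.valuation (∏ i ∈ Finset.range p, (1 - Z ^ i * A)) := by
      have : O'.valuation (Z - 1) ^ p = ∏ _i ∈ Finset.range p, O'.valuation (Z - 1) := by simp
      rw [map_prod, this]
      refine Finset.prod_le_prod' fun i _ ↦ ?_
      have := h i
      rwa [map_div₀, one_le_div₀ (zero_lt_iff.2 hπ0')] at this
    rw [hprod, Valuation.map_neg, map_mul, map_pow] at hle
    exact hle.not_gt (mul_lt_of_lt_one_right (zero_lt_iff.2 (pow_ne_zero _ hπ0')) hμ')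
  have hi' := (valuation_comap_lt_one_iff (σ : E →+* E) hσO _).2 hi
  have hσZ : σ Z = Z := σ.commutes ζ
  have e : (σ : E →+* E) ((1 - Z ^ i * A) / (Z - 1)) = (1 - Z ^ (i + 1) * A) / (Z - 1) := by
    simp [hσZ, hσ, pow_succ, mul_assoc]
  rw [e] at hi'
  have hZ1 : O'.valuation Z = 1 := by
    refine (pow_eq_one_iff_of_nonneg zero_le hp.ne_zero).1 ?_
    rw [← map_pow, hZ.pow_eq_one, map_one]
  have hi'' : O'.valuation (Z * ((1 - Z ^ i * A) / (Z - 1))) < 1 := by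
    rwa [map_mul, hZ1, one_mul]
  have hlt := O'.valuation.map_sub_lt hi'' hi'
  have e1 : Z * ((1 - Z ^ i * A) / (Z - 1)) - (1 - Z ^ (i + 1) * A) / (Z - 1) = 1 := by
    field_simp
    ring
  rw [e1, map_one] at hlt
  exact hlt.false

open IntermediateField Polynomial in
lemma norm_algebraMap_sub_gen {K Ω : Type*} [Field K] [Field Ω] [Algebra K Ω] {p : ℕ}
    (hp : p.Prime) {a : K} (hnp : ∀ b : K, b ^ p ≠ a) {α : Ω}
    (hα : α ^ p = algebraMap K Ω a) (t : K) :
    Algebra.norm K (algebraMap K K⟮α⟯ t - AdjoinSimple.gen K α) = t ^ p - a := by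
  have hint := isIntegral_of_pow_eq_algebraMap hp hα
  have := adjoin.finiteDimensional hint
  have hgen : (Algebra.lmul K K⟮α⟯ (AdjoinSimple.gen K α)).charpoly = X ^ p - C a := by
    rw [← minpoly_eq_X_pow_sub_C hp hnp hα, ← minpoly_gen K α, ← adjoin.powerBasis_gen hint,
      ← charpoly_leftMulMatrix, Algebra.leftMulMatrix_apply, LinearMap.charpoly_toMatrix]
  have heval := (Algebra.lmul K K⟮α⟯ (AdjoinSimple.gen K α)).eval_charpoly t
  rw [hgen] at heval
  simp only [eval_sub, eval_pow, eval_X, eval_C] at heval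
  rw [heval, Algebra.norm_apply, map_sub, AlgHom.commutes]

open IntermediateField in
/-- For `α ^ p = a`, the norm of `1 - e α` from `K(α)` is `1 - e ^ p a`. -/
lemma norm_one_sub_mul_gen {K Ω : Type*} [Field K] [Field Ω] [Algebra K Ω] {p : ℕ}
    (hp : p.Prime) {a : K} (hnp : ∀ b : K, b ^ p ≠ a) {α : Ω}
    (hα : α ^ p = algebraMap K Ω a) (e : K) :
    Algebra.norm K (1 - algebraMap K K⟮α⟯ e * AdjoinSimple.gen K α) = 1 - e ^ p * a := by
  rcases eq_or_ne e 0 with rfl | he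
  · simp [hp.ne_zero]
  have he' : algebraMap K K⟮α⟯ e ≠ 0 := (map_ne_zero _).2 he
  have h : 1 - algebraMap K K⟮α⟯ e * AdjoinSimple.gen K α =
      algebraMap K K⟮α⟯ e * (algebraMap K K⟮α⟯ e⁻¹ - AdjoinSimple.gen K α) := by
    rw [mul_sub, map_inv₀, mul_inv_cancel₀ he']
  rw [h, map_mul, norm_algebraMap_sub_gen hp hnp hα, Algebra.norm_algebraMap,
    finrank_adjoin_simple_of_pow_eq hp hnp hα, mul_sub, ← mul_pow, mul_inv_cancel₀ he, one_pow]

lemma IsPrimitiveRoot.valuation_natCast_sq_le {K : Type*} [Field K] (O : ValuationSubring K)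
    {p : ℕ} (hp : p.Prime) {ζ : K} (hζ : IsPrimitiveRoot ζ p) :
    O.valuation (p : K) ^ 2 ≤ O.valuation (ζ - 1) ^ p := by
  set v := O.valuation
  have hζ1 : v ζ = 1 := by
    refine (pow_eq_one_iff_of_nonneg zero_le hp.ne_zero).1 ?_
    rw [← map_pow, hζ.pow_eq_one, map_one]
  have hπ : v (ζ - 1) ≤ 1 := v.map_sub_le hζ1.le (by simp)
  obtain ⟨n, rfl⟩ := Nat.exists_eq_add_of_le' hp.one_le
  have hn : 1 ≤ n := by have := hp.two_le; omega
  have hpow : v ((n + 1 : ℕ) : K) ≤ v (ζ - 1) ^ n := by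
    rw [Nat.cast_add_one, ← hζ.prod_one_sub_pow_eq_order, map_prod]
    conv_rhs => rw [← Finset.card_range n, ← Finset.prod_const]
    refine Finset.prod_le_prod' fun k _ ↦ ?_
    rw [v.map_sub_swap, ← mul_geom_sum, map_mul]
    refine mul_le_of_le_one_right zero_le (v.map_sum_le fun i _ ↦ ?_)
    rw [map_pow, hζ1, one_pow]
  calc v ((n + 1 : ℕ) : K) ^ 2 ≤ (v (ζ - 1) ^ n) ^ 2 := by gcongr
    _ = v (ζ - 1) ^ (n * 2) := (pow_mul _ _ _).symm
    _ ≤ v (ζ - 1) ^ (n + 1) := pow_le_pow_of_le_one zero_le hπ (by omega)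

open IntermediateField in
/-- Let `(K,v)` be a `p`-henselian valued field of mixed characteristic
`(0,p)` containing a primitive `p`-th root of unity, with `O_v[1/p] = K` and `Kˣ/(Kˣ)^p`
finite. If `Γ_v = pΓ_v` (expressed as: `Kˣ` is generated by `p`-th powers and units of `O`)
then for every `a ∈ Kˣ` which is not a `p`-th power, the norm map of `L = K(α)` (`α` a root
of `X^p - a`) is surjective onto `Kˣ`. -/
theorem statement_5 (p : ℕ) (hp : p.Prime) (K : Type) [Field K] [CharZero K]
    (O : ValuationSubring K) (hhens : IsPHenselian p O)
    (hres : ringChar (IsLocalRing.ResidueField ↥O) = p)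
    (hζ : ∃ ζ : K, IsPrimitiveRoot ζ p)
    (hgen : Subring.closure ((O : Set K) ∪ {(p : K)⁻¹}) = ⊤)
    (hfin : Finite (Kˣ ⧸ (powMonoidHom p : Kˣ →* Kˣ).range))
    (hdiv : (powMonoidHom p : Kˣ →* Kˣ).range ⊔ O.unitGroup = ⊤)
    (a : K) (ha : a ≠ 0) (hnp : ∀ b : K, b ^ p ≠ a)
    (α : AlgebraicClosure K) (hα : α ^ p = algebraMap K (AlgebraicClosure K) a) :
    ∀ c : Kˣ, ∃ z : ↥K⟮α⟯, Algebra.norm K z = (c : K) := by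
  have hpv : O.valuation (p : K) < 1 := by
    have h0 : IsLocalRing.residue O (p : O) = 0 := by
      rw [map_natCast, ← hres]
      exact ringChar.Nat.cast_ringChar
    simpa using (O.valuation_lt_one_iff _).1 ((IsLocalRing.residue_eq_zero_iff _).1 h0)
  obtain ⟨ζ, hζ⟩ := hζ
  intro c
  obtain ⟨w, x, rfl, hx⟩ := exists_pow_mul_one_add hp hpv hdiv ha
  obtain ⟨w', y, hc, hy⟩ := exists_pow_mul_one_add hp hpv hdiv c.ne_zero
  have hw0 : w ≠ 0 := by rintro rfl; simp [hp.ne_zero] at ha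
  have hx0 : x ≠ 0 := by rintro rfl; exact hnp w (by simp)
  have hx1 : O.valuation (1 + x) = 1 := O.valuation.map_one_add_of_lt (hx.trans hpv)
  have hx1' : 1 + x ≠ 0 := fun h ↦ by simp [h] at hx1
  have hπ0 : ζ - 1 ≠ 0 := sub_ne_zero.2 (hζ.ne_one hp.one_lt)
  obtain ⟨b, hb⟩ := hhens.exists_pow_eq hp hζ (μ := x * y / (1 + x) / (ζ - 1) ^ p) (by
    rw [map_div₀, map_div₀, hx1, div_one, map_pow, map_mul]
    refine (div_lt_one₀ (pow_pos (zero_lt_iff.2 ((Valuation.ne_zero_iff _).2 hπ0)) p)).2 ?_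
    refine lt_of_lt_of_le ?_ (hζ.valuation_natCast_sq_le O hp)
    rw [sq]
    exact mul_lt_mul'' hx hy zero_le zero_le)
  rw [mul_div_cancel₀ _ (pow_ne_zero p hπ0)] at hb
  have hwp : w⁻¹ ^ p * (w ^ p * (1 + x)) = 1 + x := by
    rw [← mul_assoc, ← mul_pow, inv_mul_cancel₀ hw0, one_pow, one_mul]
  set D := 1 - algebraMap K K⟮α⟯ w⁻¹ * AdjoinSimple.gen K α
  have hD : Algebra.norm K D = -x := by
    rw [norm_one_sub_mul_gen hp hnp hα, hwp]; ring
  have hD0 : D ≠ 0 := fun h ↦ by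
    have := adjoin.finiteDimensional (isIntegral_of_pow_eq_algebraMap hp hα)
    rw [h, Algebra.norm_zero] at hD
    exact neg_ne_zero.2 hx0 hD.symm
  set F := 1 - algebraMap K K⟮α⟯ (b * w⁻¹) * AdjoinSimple.gen K α
  have hF : Algebra.norm K F = -x * (1 + y) := by
    rw [norm_one_sub_mul_gen hp hnp hα, mul_pow, mul_assoc, hwp, hb]
    field_simp
    ring
  refine ⟨algebraMap K K⟮α⟯ w' * (F / D), mul_right_cancel₀ (neg_ne_zero.2 hx0) ?_⟩
  rw [← hD, ← map_mul, mul_assoc, div_mul_cancel₀ _ hD0, map_mul, hF, hD, hc,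
    Algebra.norm_algebraMap, finrank_adjoin_simple_of_pow_eq hp hnp hα]
  ring
end
end

section
/- Let K be a field. If K admits two nontrivial solv-henselian valuations which are independent, then K is solv-closed: every finite Galois extension of K with solvable Galois group is trivial. -/
noncomputable section

/-- The maximal solvable extension of `K` inside an ambient field extension `Ω`:
the compositum of all finite Galois subextensions of `Ω/K` with solvable Galois group. -/
def maxSolvableExt (K Ω : Type*) [Field K] [Field Ω] [Algebra K Ω] :
    IntermediateField K Ω :=
  ⨆ L : {L : IntermediateField K Ω //
      FiniteDimensional K ↥L ∧ IsGalois K ↥L ∧ IsSolvable (↥L ≃ₐ[K] ↥L)}, L.1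

/-- `K^solv`, the maximal solvable extension of `K` (inside a fixed algebraic closure). -/
abbrev solvClosure (K : Type*) [Field K] : IntermediateField K (AlgebraicClosure K) :=
  maxSolvableExt K (AlgebraicClosure K)

/-- A valuation (subring) of `K` is solv-henselian if it extends uniquely to `K^solv`. -/
def IsSolvHenselian {K : Type*} [Field K] (O : ValuationSubring K) : Prop :=
  ∃! O' : ValuationSubring ↥(solvClosure K),
    O'.comap (algebraMap K ↥(solvClosure K)) = O

/-- A field is solv-closed if it admits no nontrivial finite Galois extension with
solvable Galois group. -/
def IsSolvClosed (K : Type*) [Field K] : Prop :=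
  ∀ L : IntermediateField K (AlgebraicClosure K),
    FiniteDimensional K ↥L → IsGalois K ↥L → IsSolvable (↥L ≃ₐ[K] ↥L) → L = ⊥

/-- A Krasner-type principle: if a point `a` of the base field is close to a Galois-stable finite
set `S`, compared with the distances between the points of `S`, then `S` contains a point of the
base field. -/
theorem exists_mem_range_of_prod_lt {F Ω Γ : Type*} [Field F] [Field Ω] [Algebra F Ω]
    [IsGalois F Ω] [LinearOrderedCommGroupWithZero Γ] (v : Valuation Ω Γ)
    (hv : ∀ (σ : Gal(Ω/F)) (x : Ω), v x < 1 → v (σ x) < 1) (S : Finset Ω)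
    (hS : ∀ σ : Gal(Ω/F), ∀ r ∈ S, σ r ∈ S) (a d : F) (hd : d ≠ 0)
    (hsep : ∀ r ∈ S, ∀ s ∈ S, r ≠ s → v (algebraMap F Ω d) ≤ v (r - s))
    (h : v (∏ r ∈ S, (algebraMap F Ω a - r)) < v (algebraMap F Ω d) ^ S.card) :
    ∃ r ∈ S, r ∈ Set.range (algebraMap F Ω) := by
  have hd' : algebraMap F Ω d ≠ 0 := by simpa using hd
  have hvd : 0 < v (algebraMap F Ω d) := zero_lt_iff.mpr ((Valuation.ne_zero_iff v).mpr hd')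
  obtain ⟨r, hr, hlt⟩ : ∃ r ∈ S, v (algebraMap F Ω a - r) < v (algebraMap F Ω d) := by
    by_contra! hcon
    refine absurd h (not_lt.mpr ?_)
    rw [map_prod, ← Finset.prod_const]
    exact Finset.prod_le_prod' hcon
  refine ⟨r, hr, IntermediateField.mem_bot.mp
    ((InfiniteGalois.mem_bot_iff_fixed r).mpr fun σ ↦ ?_)⟩
  by_contra hne
  have hσ : v (algebraMap F Ω a - σ r) < v (algebraMap F Ω d) := by
    have key := hv σ ((algebraMap F Ω a - r) / algebraMap F Ω d)
      (by rw [map_div₀]; exact (div_lt_one₀ hvd).mpr hlt)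
    rw [map_div₀, map_div₀, map_sub, σ.commutes, σ.commutes] at key
    exact (div_lt_one₀ hvd).mp key
  refine absurd (hsep _ (hS σ r hr) _ hr hne) (not_le.mpr ?_)
  calc v (σ r - r) = v ((algebraMap F Ω a - r) - (algebraMap F Ω a - σ r)) := by congr 1; ring
    _ < _ := v.map_sub_lt hlt hσ

theorem exists_mul_eq_of_sup_eq_top {K : Type*} [Field K] {A B : ValuationSubring K}
    (h : A.toSubring ⊔ B.toSubring = ⊤) (x : K) : ∃ a ∈ A, ∃ b ∈ B, a * b = x := by
  have hadd1 : ∀ s ∈ A, ∀ t ∈ B, ∃ a ∈ A, ∃ b ∈ B, a * b = s + t := by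
    intro s hs t ht
    by_cases hsB : s ∈ B
    · exact ⟨1, A.one_mem, s + t, B.add_mem _ _ hsB ht, one_mul _⟩
    have ht' : t = 0 ∨ (t ≠ 0 ∧ t⁻¹ ∈ A) ∨ t ∈ A := by
      rcases eq_or_ne t 0 with h0 | h0
      · exact Or.inl h0
      · exact Or.inr ((A.mem_or_inv_mem t).symm.imp (fun h ↦ ⟨h0, h⟩) id)
    rcases ht' with rfl | ⟨ht0, htA⟩ | htA
    · exact ⟨s, hs, 1, B.one_mem, by ring⟩
    · refine ⟨1 + s * t⁻¹, A.add_mem _ _ A.one_mem (A.mul_mem _ _ hs htA), t, ht, ?_⟩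
      field_simp
      ring
    · exact ⟨s + t, A.add_mem _ _ hs htA, 1, B.one_mem, mul_one _⟩
  have hmul1 : ∀ s ∈ A, ∀ t ∈ B, ∃ a ∈ A, ∃ b ∈ B, a * b = 1 + s * t := by
    intro s hs t ht
    rcases A.mem_or_inv_mem (s * t) with hA | hA
    · exact ⟨1 + s * t, A.add_mem _ _ A.one_mem hA, 1, B.one_mem, mul_one _⟩
    rcases B.mem_or_inv_mem (s * t) with hB | hB
    · exact ⟨1, A.one_mem, 1 + s * t, B.add_mem _ _ B.one_mem hB, one_mul _⟩
    rcases eq_or_ne (s * t) 0 with h0 | h0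
    · exact ⟨1, A.one_mem, 1, B.one_mem, by rw [h0]; ring⟩
    refine ⟨s * (1 + (s * t)⁻¹), A.mul_mem _ _ hs (A.add_mem _ _ A.one_mem hA), t, ht, ?_⟩
    calc s * (1 + (s * t)⁻¹) * t = s * t + (s * t) * (s * t)⁻¹ := by ring
      _ = _ := by rw [mul_inv_cancel₀ h0, add_comm]
  have hdiv : ∀ (C : ValuationSubring K) (u w : K), (∃ q ∈ C, u = w * q) ∨ ∃ q ∈ C, w = u * q := by
    intro C u w
    rcases eq_or_ne u 0 with rfl | hu
    · exact Or.inl ⟨0, C.zero_mem, by simp⟩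
    rcases eq_or_ne w 0 with rfl | hw
    · exact Or.inr ⟨0, C.zero_mem, by simp⟩
    rcases C.mem_or_inv_mem (u / w) with h | h
    · exact Or.inl ⟨_, h, by field_simp⟩
    · exact Or.inr ⟨_, h, by field_simp⟩
  have hsame : ∀ a₁ ∈ A, ∀ a₂ ∈ A, ∀ t ∈ B, ∃ a ∈ A, ∃ b ∈ B, a * b = a₁ * t + a₂ := by
    intro a₁ h₁ a₂ h₂ t ht
    rcases hdiv A a₁ a₂ with ⟨q, hq, rfl⟩ | ⟨q, hq, rfl⟩
    · obtain ⟨a, ha, b, hb, hab⟩ := hmul1 q hq t ht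
      exact ⟨a₂ * a, A.mul_mem _ _ h₂ ha, b, hb, by rw [mul_assoc, hab]; ring⟩
    · obtain ⟨a, ha, b, hb, hab⟩ := hadd1 q hq t ht
      exact ⟨a₁ * a, A.mul_mem _ _ h₁ ha, b, hb, by rw [mul_assoc, hab]; ring⟩
  have hadd : ∀ u w : K, (∃ a ∈ A, ∃ b ∈ B, a * b = u) → (∃ a ∈ A, ∃ b ∈ B, a * b = w) →
      ∃ a ∈ A, ∃ b ∈ B, a * b = u + w := by
    rintro _ _ ⟨a₁, h₁, b₁, k₁, rfl⟩ ⟨a₂, h₂, b₂, k₂, rfl⟩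
    rcases hdiv B b₁ b₂ with ⟨q, hq, rfl⟩ | ⟨q, hq, rfl⟩
    · obtain ⟨a, ha, b, hb, hab⟩ := hsame a₁ h₁ a₂ h₂ q hq
      exact ⟨a, ha, b * b₂, B.mul_mem _ _ hb k₂, by rw [← mul_assoc, hab]; ring⟩
    · obtain ⟨a, ha, b, hb, hab⟩ := hsame a₂ h₂ a₁ h₁ q hq
      exact ⟨a, ha, b * b₁, B.mul_mem _ _ hb k₁, by rw [← mul_assoc, hab]; ring⟩
  let R : Subring K :=
    { carrier := {x | ∃ a ∈ A, ∃ b ∈ B, a * b = x}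
      mul_mem' := by
        rintro _ _ ⟨a₁, h₁, b₁, k₁, rfl⟩ ⟨a₂, h₂, b₂, k₂, rfl⟩
        exact ⟨a₁ * a₂, A.mul_mem _ _ h₁ h₂, b₁ * b₂, B.mul_mem _ _ k₁ k₂, by ring⟩
      one_mem' := ⟨1, A.one_mem, 1, B.one_mem, one_mul 1⟩
      add_mem' := fun {u w} hu hw ↦ hadd u w hu hw
      zero_mem' := ⟨0, A.zero_mem, 1, B.one_mem, zero_mul 1⟩
      neg_mem' := by
        rintro _ ⟨a, ha, b, hb, rfl⟩
        exact ⟨-a, A.neg_mem _ ha, b, hb, by ring⟩ }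
  have hR : (⊤ : Subring K) ≤ R := h ▸ sup_le
    (fun a ha ↦ ⟨a, ha, 1, B.one_mem, mul_one a⟩) (fun b hb ↦ ⟨1, A.one_mem, b, hb, one_mul b⟩)
  exact hR (Subring.mem_top x)

theorem exists_valuation_lt_of_isAlgebraic {K Ω : Type*} [Field K] [Field Ω] [Algebra K Ω]
    [Algebra.IsAlgebraic K Ω] {O : ValuationSubring K} (hO : O ≠ ⊤) {V : ValuationSubring Ω}
    (hV : V.comap (algebraMap K Ω) = O) (g : Ω) (hg : g ≠ 0) :
    ∃ h : K, h ≠ 0 ∧ V.valuation (algebraMap K Ω h) < V.valuation g ∧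
      V.valuation (algebraMap K Ω h) < 1 := by
  have hmem : ∀ x : K, x ∈ O ↔ algebraMap K Ω x ∈ V := fun x ↦ by rw [← hV]; rfl
  obtain ⟨w, hw⟩ : ∃ w : K, w ∉ O := by
    by_contra! hcon
    exact hO (top_le_iff.mp fun x _ ↦ hcon x)
  have hw0 : w ≠ 0 := fun h ↦ hw (h ▸ O.zero_mem)
  have hπ : V.valuation (algebraMap K Ω w⁻¹) < 1 := by
    rw [map_inv₀, map_inv₀]
    refine inv_lt_one_of_one_lt₀ (not_le.mp fun hle ↦ hw ?_)
    exact (hmem w).mpr ((V.valuation_le_one_iff _).mp hle)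
  have main : ∀ g : Ω, g ≠ 0 → ∃ h : K, h ≠ 0 ∧
      V.valuation (algebraMap K Ω h) < V.valuation g := by
    intro g hg
    have halg : Algebra.IsAlgebraic O Ω :=
      (IsFractionRing.comap_isAlgebraic_iff (A := O) (K := K)).mpr inferInstance
    obtain ⟨y, hy, h_integral⟩ := (halg.isAlgebraic g⁻¹).exists_integral_multiple
    have hyV : y • g⁻¹ ∈ V := by
      obtain ⟨q, hq, hq'⟩ := h_integral
      let f : O →+* V := ((algebraMap K Ω).comp O.subtype).codRestrict V.toSubring
        fun x ↦ (hmem x).mp x.2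
      have : IsIntegral V (y • g⁻¹) := by
        refine ⟨q.map f, hq.map f, ?_⟩
        rw [Polynomial.eval₂_map]
        exact hq'
      obtain ⟨z, hz⟩ := IsIntegrallyClosed.isIntegral_iff.mp this
      rw [← hz]
      exact z.2
    have hy0 : (y : K) ≠ 0 := by simpa using hy
    rw [Algebra.smul_def, IsScalarTower.algebraMap_apply O K Ω] at hyV
    refine ⟨y * w⁻¹, mul_ne_zero hy0 (inv_ne_zero hw0), ?_⟩
    have h1 := (V.valuation_le_one_iff _).mpr hyV
    have hvg : 0 < V.valuation g := zero_lt_iff.mpr ((Valuation.ne_zero_iff _).mpr hg)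
    rw [map_mul, map_inv₀, ← div_eq_mul_inv, div_le_one₀ hvg] at h1
    rw [map_mul, map_mul]
    calc _ < V.valuation (algebraMap K Ω y) * 1 := by
          refine mul_lt_mul_of_pos_left hπ (zero_lt_iff.mpr ((Valuation.ne_zero_iff _).mpr ?_))
          simpa using hy0
      _ ≤ _ := by rw [mul_one]; exact h1
  rcases le_total (V.valuation g) 1 with h1 | h1
  · obtain ⟨h, h0, hh⟩ := main g hg
    exact ⟨h, h0, hh, hh.trans_le h1⟩
  · obtain ⟨h, h0, hh⟩ := main 1 one_ne_zero
    rw [map_one] at hh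
    exact ⟨h, h0, hh.trans_le h1, hh⟩

theorem exists_approx_zero_one {K Ω : Type*} [Field K] [Field Ω] [Algebra K Ω]
    [Algebra.IsAlgebraic K Ω] {O₁ O₂ : ValuationSubring K} (h₁ : O₁ ≠ ⊤) (h₂ : O₂ ≠ ⊤)
    (hindep : O₁.toSubring ⊔ O₂.toSubring = ⊤) {V₁ V₂ : ValuationSubring Ω}
    (hV₁ : V₁.comap (algebraMap K Ω) = O₁) (hV₂ : V₂.comap (algebraMap K Ω) = O₂)
    (g₁ g₂ : Ω) (hg₁ : g₁ ≠ 0) (hg₂ : g₂ ≠ 0) :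
    ∃ e : K, V₁.valuation (algebraMap K Ω e) < V₁.valuation g₁ ∧
      V₂.valuation (1 - algebraMap K Ω e) < V₂.valuation g₂ := by
  obtain ⟨x₁, hx₁, hlt₁, hone₁⟩ := exists_valuation_lt_of_isAlgebraic h₁ hV₁ g₁ hg₁
  obtain ⟨x₂, hx₂, hlt₂, hone₂⟩ := exists_valuation_lt_of_isAlgebraic h₂ hV₂ g₂ hg₂
  obtain ⟨a, ha, b, hb, hab⟩ := exists_mul_eq_of_sup_eq_top hindep (x₁ * x₂)⁻¹
  have hx₁' : algebraMap K Ω x₁ ≠ 0 := by simpa using hx₁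
  have hx₂' : algebraMap K Ω x₂ ≠ 0 := by simpa using hx₂
  have hab0 : a * b ≠ 0 := hab ▸ inv_ne_zero (mul_ne_zero hx₁ hx₂)
  have ha0 : a ≠ 0 := left_ne_zero_of_mul hab0
  have hb0 : b ≠ 0 := right_ne_zero_of_mul hab0
  have hxb : x₁ * a = (x₂ * b)⁻¹ := by
    rw [mul_inv] at hab
    field_simp at hab ⊢
    linear_combination hab
  have hmem : ∀ {O : ValuationSubring K} {V : ValuationSubring Ω},
      V.comap (algebraMap K Ω) = O → ∀ {x : K}, x ∈ O → V.valuation (algebraMap K Ω x) ≤ 1 := by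
    rintro O V rfl x hx
    exact (V.valuation_le_one_iff _).mpr hx
  have hv₁ : V₁.valuation (algebraMap K Ω (x₁ * a)) ≤ V₁.valuation (algebraMap K Ω x₁) := by
    rw [map_mul, map_mul]
    exact mul_le_of_le_one_right' (hmem hV₁ ha)
  have hv₂ : V₂.valuation (algebraMap K Ω (x₂ * b)) ≤ V₂.valuation (algebraMap K Ω x₂) := by
    rw [map_mul, map_mul]
    exact mul_le_of_le_one_right' (hmem hV₂ hb)
  have hu₁ : V₁.valuation (1 + algebraMap K Ω (x₁ * a)) = 1 :=
    Valuation.map_one_add_of_lt _ (hv₁.trans_lt hone₁)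
  have hu₂ : V₂.valuation (1 + algebraMap K Ω (x₂ * b)) = 1 :=
    Valuation.map_one_add_of_lt _ (hv₂.trans_lt hone₂)
  have hne : 1 + algebraMap K Ω (x₁ * a) ≠ 0 := fun h ↦ by
    rw [h, map_zero] at hu₁
    exact zero_ne_one hu₁
  have hne₂ : 1 + algebraMap K Ω (x₂ * b) ≠ 0 := fun h ↦ by
    rw [h, map_zero] at hu₂
    exact zero_ne_one hu₂
  refine ⟨x₁ * a / (1 + x₁ * a), ?_, ?_⟩
  · rw [map_div₀, map_div₀, map_add, map_one, hu₁, div_one]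
    exact hv₁.trans_lt hlt₁
  · have : 1 - algebraMap K Ω (x₁ * a / (1 + x₁ * a)) =
        algebraMap K Ω (x₂ * b) / (1 + algebraMap K Ω (x₂ * b)) := by
      rw [map_div₀, map_add, map_one, one_sub_div hne, hxb, map_inv₀]
      have : algebraMap K Ω (x₂ * b) ≠ 0 := by simp [hx₂, hb0]
      rw [hxb, map_inv₀] at hne
      rw [div_eq_div_iff hne hne₂]
      linear_combination -(mul_inv_cancel₀ this)
    rw [this, map_div₀, hu₂, div_one]
    exact hv₂.trans_lt hlt₂

theorem ZMod.prod_sub_castHom_eq {Ω : Type*} [Field Ω] {p : ℕ} [Fact p.Prime]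
    (φ : ZMod p →+* Ω) (x : Ω) : ∏ i : ZMod p, (x - φ i) = x ^ p - x := by
  have h1 := (FiniteField.roots_X_pow_card_sub_X (ZMod p))
  have h2 : (Polynomial.X ^ p - Polynomial.X : Polynomial (ZMod p)) =
      ∏ i : ZMod p, (Polynomial.X - Polynomial.C i) := by
    rw [ZMod.card p] at h1
    have h3 := Polynomial.prod_multiset_X_sub_C_of_monic_of_roots_card_eq
      (p := (Polynomial.X ^ p - Polynomial.X : Polynomial (ZMod p)))
      (Polynomial.monic_X_pow_sub (by
        rw [Polynomial.degree_X]
        exact_mod_cast (Fact.out : p.Prime).one_lt))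
      (by
        rw [h1, FiniteField.X_pow_card_sub_X_natDegree_eq _ (Fact.out : p.Prime).one_lt]
        simp)
    rw [← h3, h1]
    rfl
  have h4 := congrArg (Polynomial.eval₂ φ x) h2
  rw [Polynomial.eval₂_finsetProd] at h4
  simpa using h4.symm

theorem ZMod.exists_castHom_eq_of_pow_eq {Ω : Type*} [Field Ω] {p : ℕ} [Fact p.Prime]
    (φ : ZMod p →+* Ω) (x : Ω) (hx : x ^ p = x) : ∃ i, φ i = x := by
  have := ZMod.prod_sub_castHom_eq φ x
  rw [hx, sub_self, Finset.prod_eq_zero_iff] at this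
  obtain ⟨i, -, hi⟩ := this
  exact ⟨i, (sub_eq_zero.mp hi).symm⟩

theorem mem_range_of_pow_sub_self {F Ω Γ : Type*} [Field F] [Field Ω] [Algebra F Ω]
    [IsGalois F Ω] [LinearOrderedCommGroupWithZero Γ] (v : Valuation Ω Γ)
    (hv : ∀ (σ : Gal(Ω/F)) (x : Ω), v x < 1 → v (σ x) < 1) {p : ℕ} [Fact p.Prime] [CharP F p]
    {d : F} (hd : v (algebraMap F Ω d) < 1) {z : Ω} (hz : z ^ p - z = algebraMap F Ω d) :
    z ∈ Set.range (algebraMap F Ω) := by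
  classical
  have : CharP Ω p := charP_of_injective_algebraMap (algebraMap F Ω).injective p
  let φ : ZMod p →+* Ω := (algebraMap F Ω).comp (ZMod.castHom dvd_rfl F)
  have hφ : ∀ i, φ i ∈ Set.range (algebraMap F Ω) := fun i ↦ ⟨_, rfl⟩
  have hinj : Function.Injective fun i ↦ z + φ i := (add_right_injective z).comp φ.injective
  obtain ⟨r, hr, hrF⟩ := exists_mem_range_of_prod_lt v hv (Finset.univ.image fun i ↦ z + φ i)
    (fun σ r hr ↦ by
      simp only [Finset.mem_image, Finset.mem_univ, true_and] at hr ⊢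
      obtain ⟨i, rfl⟩ := hr
      obtain ⟨j, hj⟩ := ZMod.exists_castHom_eq_of_pow_eq φ (σ z - z) (by
        have := congrArg σ hz
        rw [σ.commutes, ← hz, map_sub, map_pow] at this
        rw [sub_pow_char]
        linear_combination this)
      refine ⟨j + i, ?_⟩
      have hi : σ (φ i) = φ i := σ.commutes _
      rw [map_add, hj, map_add, hi]
      ring)
    0 1 one_ne_zero
    (fun r hr s hs hrs ↦ by
      simp only [Finset.mem_image, Finset.mem_univ, true_and] at hr hs
      obtain ⟨i, rfl⟩ := hr
      obtain ⟨j, rfl⟩ := hs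
      have hne : i - j ≠ 0 := fun h ↦ hrs (by rw [sub_eq_zero.mp h])
      have hone : v (φ (i - j)) ^ (p - 1) = 1 := by
        rw [← map_pow, ← map_pow, ZMod.pow_card_sub_one_eq_one hne, map_one, map_one]
      have hp : p - 1 ≠ 0 := Nat.sub_ne_zero_of_lt (Fact.out : p.Prime).one_lt
      rw [map_one, map_one, add_sub_add_left_eq_sub, ← map_sub,
        (pow_eq_one_iff_of_nonneg zero_le hp).mp hone])
    (by
      rw [Finset.prod_image hinj.injOn, map_one, map_one, one_pow]
      have h1 : ∀ i, algebraMap F Ω 0 - (z + φ i) = -z - φ i := fun i ↦ by rw [map_zero]; ring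
      simp_rw [h1]
      rw [ZMod.prod_sub_castHom_eq, ← zero_sub, sub_pow_char, zero_pow (Fact.out : p.Prime).ne_zero,
        ← Valuation.map_neg, show -(0 - z ^ p - (0 - z)) = z ^ p - z by ring, hz]
      exact hd)
  simp only [Finset.mem_image, Finset.mem_univ, true_and] at hr
  obtain ⟨i, rfl⟩ := hr
  obtain ⟨f, hf⟩ := hrF
  obtain ⟨g, hg⟩ := hφ i
  exact ⟨f - g, by rw [map_sub, hf, hg]; ring⟩

theorem mem_range_of_pow_eq {F Ω Γ : Type*} [Field F] [Field Ω] [Algebra F Ω]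
    [IsGalois F Ω] [LinearOrderedCommGroupWithZero Γ] (v : Valuation Ω Γ)
    (hv : ∀ (σ : Gal(Ω/F)) (x : Ω), v x < 1 → v (σ x) < 1) {n : ℕ} (hn : (n : F) ≠ 0)
    {ζ : F} (hζ : IsPrimitiveRoot ζ n) (hvn : v (n : Ω) ≤ 1)
    {b : F} (hb : v (algebraMap F Ω b - 1) < v (n : Ω) ^ n) {z : Ω}
    (hz : z ^ n = algebraMap F Ω b) :
    z ∈ Set.range (algebraMap F Ω) := by
  classical
  have hn0 : n ≠ 0 := fun h ↦ hn (by rw [h, Nat.cast_zero])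
  have hζ' : IsPrimitiveRoot (algebraMap F Ω ζ) n := hζ.map_of_injective (algebraMap F Ω).injective
  have hroot : ∀ η : Ω, η ^ n = 1 → ∃ f : F, algebraMap F Ω f = η := fun η hη ↦ by
    have : NeZero n := ⟨hn0⟩
    obtain ⟨i, -, hi⟩ := hζ'.eq_pow_of_pow_eq_one hη
    exact ⟨ζ ^ i, by rw [map_pow, hi]⟩
  have hvone : ∀ {η : Ω}, v η ^ n = 1 → v η = 1 := fun h ↦
    (pow_eq_one_iff_of_nonneg zero_le hn0).mp h
  have hvb : v (algebraMap F Ω b) = 1 := by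
    have := Valuation.map_one_add_of_lt v (hb.trans_le (pow_le_one' hvn n))
    rwa [add_sub_cancel] at this
  have hvz : v z = 1 := hvone (by rw [← map_pow, hz, hvb])
  have hz0 : z ≠ 0 := fun h ↦ by simp [h] at hvz
  have hvroot : ∀ η : Ω, η ^ n = 1 → v η = 1 := fun η hη ↦ hvone (by rw [← map_pow, hη, map_one])
  have hdist : ∀ η : Ω, η ^ n = 1 → η ≠ 1 → v (n : Ω) ≤ v (1 - η) := fun η hη hη1 ↦ by
    obtain ⟨m, rfl⟩ := Nat.exists_eq_succ_of_ne_zero hn0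
    obtain ⟨i, hi, rfl⟩ := hζ'.eq_pow_of_pow_eq_one hη
    obtain ⟨k, rfl⟩ := Nat.exists_eq_succ_of_ne_zero (n := i) (by rintro rfl; simp at hη1)
    have hk : k ∈ Finset.range m := Finset.mem_range.mpr (by omega)
    have key := congrArg v hζ'.prod_one_sub_pow_eq_order
    rw [← Finset.mul_prod_erase _ _ hk, map_mul, map_prod] at key
    rw [Nat.succ_eq_add_one, Nat.cast_add_one, ← key]
    refine mul_le_of_le_one_right' (Finset.prod_le_one' fun j _ ↦ ?_)
    refine (v.map_sub _ _).trans (max_le (map_one v).le (hvroot _ ?_).le)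
    rw [← pow_mul, mul_comm, pow_mul, hζ'.pow_eq_one, one_pow]
  have hmem : ∀ r, r ∈ (Polynomial.nthRootsFinset n (1 : Ω)).image (· * z) ↔
      ∃ η : Ω, η ^ n = 1 ∧ η * z = r := fun r ↦ by
    simp [Polynomial.mem_nthRootsFinset (Nat.pos_of_ne_zero hn0)]
  obtain ⟨r, hr, f, hf⟩ := exists_mem_range_of_prod_lt v hv
    ((Polynomial.nthRootsFinset n (1 : Ω)).image (· * z))
    (fun σ r hr ↦ by
      rw [hmem] at hr ⊢
      obtain ⟨η, hη, rfl⟩ := hr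
      refine ⟨η * (σ z / z), ?_, ?_⟩
      · rw [mul_pow, hη, div_pow, ← map_pow, hz, σ.commutes, ← hz, div_self (pow_ne_zero _ hz0),
          one_mul]
      · obtain ⟨f, rfl⟩ := hroot η hη
        rw [map_mul, σ.commutes]
        field_simp)
    1 (n : F) hn
    (fun r hr s hs hrs ↦ by
      rw [hmem] at hr hs
      obtain ⟨η, hη, rfl⟩ := hr
      obtain ⟨θ, hθ, rfl⟩ := hs
      have hη0 : η ≠ 0 := fun h ↦ by simp [h, hn0] at hη
      rw [map_natCast, show η * z - θ * z = (1 - θ / η) * η * z by field_simp, map_mul, map_mul,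
        hvz, hvroot η hη, mul_one, mul_one]
      refine hdist _ (by rw [div_pow, hη, hθ, div_one]) fun h ↦ hrs ?_
      rw [(div_eq_one_iff_eq hη0).mp h])
    (by
      have hinj : Function.Injective fun η : Ω ↦ η * z := mul_left_injective₀ hz0
      rw [Finset.prod_image hinj.injOn, Finset.card_image_of_injective _ hinj, map_one,
        ← hζ'.pow_sub_pow_eq_prod_sub_mul 1 z (Nat.pos_of_ne_zero hn0), one_pow, hz,
        hζ'.card_nthRootsFinset, map_natCast, Valuation.map_sub_swap]
      exact hb)
  obtain ⟨η, hη, rfl⟩ := (hmem r).mp hr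
  have hη0 : η ≠ 0 := fun h ↦ by simp [h, hn0] at hη
  obtain ⟨g, hg⟩ := hroot η hη
  refine ⟨f / g, ?_⟩
  rw [map_div₀, hf, hg]
  field_simp

theorem Group.IsSolvable.exists_normal_index_prime (G : Type*) [Group G] [Finite G] [Nontrivial G]
    [Group.IsSolvable G] : ∃ N : Subgroup G, N.Normal ∧ N.index.Prime := by
  have : Nontrivial (Abelianization G) := QuotientGroup.nontrivial_iff.mpr
    (Group.IsSolvable.commutator_lt_top_of_nontrivial G).ne
  obtain ⟨H, hH, -⟩ := (eq_top_or_exists_le_coatom (⊥ : Subgroup (Abelianization G))).resolve_left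
    bot_ne_top
  have hnt : Nontrivial (Abelianization G ⧸ H) := QuotientGroup.nontrivial_iff.mpr hH.1
  have hsimple : IsSimpleGroup (Abelianization G ⧸ H) := ⟨fun N _ ↦ by
    have hinj := Subgroup.comap_injective (QuotientGroup.mk'_surjective H)
    have hle : H ≤ N.comap (QuotientGroup.mk' H) := by
      conv_lhs => rw [← QuotientGroup.ker_mk' H]
      exact Subgroup.comap_mono bot_le
    rcases hH.le_iff.mp hle with h | h
    · exact Or.inr (hinj (by rw [h, Subgroup.comap_top]))
    · refine Or.inl (hinj ?_)
      rw [h, MonoidHom.comap_bot, QuotientGroup.ker_mk']⟩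
  refine ⟨H.comap Abelianization.of, inferInstance, ?_⟩
  rw [Subgroup.index_comap_of_surjective _ (QuotientGroup.mk_surjective)]
  exact CommGroup.is_simple_iff_prime_card.mp hsimple

theorem IsGalois.exists_intermediateField_finrank_prime (K L : Type*) [Field K] [Field L]
    [Algebra K L] [FiniteDimensional K L] [IsGalois K L] [Nontrivial Gal(L/K)]
    [Group.IsSolvable Gal(L/K)] :
    ∃ M : IntermediateField K L, IsGalois K M ∧ (Module.finrank K M).Prime := by
  obtain ⟨N, hN, hp⟩ := Group.IsSolvable.exists_normal_index_prime Gal(L/K)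
  refine ⟨IntermediateField.fixedField N, inferInstance, ?_⟩
  rwa [← IsGalois.card_aut_eq_finrank,
    ← Nat.card_congr (IsGalois.normalAutEquivQuotient N).toEquiv]

theorem IsGalois.exists_pow_sub_self_mem (K M : Type*) [Field K] [Field M] [Algebra K M]
    [FiniteDimensional K M] [IsGalois K M] {p : ℕ} [Fact p.Prime] [CharP K p]
    (hM : Module.finrank K M = p) :
    ∃ y : M, y ∉ Set.range (algebraMap K M) ∧ y ^ p - y ∈ Set.range (algebraMap K M) := by
  have : CharP M p := charP_of_injective_algebraMap (algebraMap K M).injective p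
  have hcard : Nat.card Gal(M/K) = p := by rw [IsGalois.card_aut_eq_finrank, hM]
  let g : Multiplicative (ZMod p) ≃* Gal(M/K) := mulEquivOfPrimeCardEq (p := p) (by simp) hcard
  let φ : ZMod p →+* M := (algebraMap K M).comp (ZMod.castHom dvd_rfl K)
  obtain ⟨θ, hθ⟩ := Algebra.trace_surjective K M 1
  have hsum : ∑ i : ZMod p, g (.ofAdd i) θ = 1 := by
    have h := trace_eq_sum_automorphisms (K := K) θ
    rw [hθ, map_one] at h
    rw [h]
    exact Fintype.sum_equiv (Multiplicative.ofAdd.trans g.toEquiv) _ _ fun _ ↦ rfl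
  let y : M := ∑ i : ZMod p, φ (-i) * g (.ofAdd i) θ
  have hy : ∀ k : ZMod p, g (.ofAdd k) y = y + φ k := by
    intro k
    calc g (.ofAdd k) y = ∑ i : ZMod p, φ (-i) * g (.ofAdd (k + i)) θ := by
          simp only [y, map_sum, map_mul]
          refine Finset.sum_congr rfl fun i _ ↦ ?_
          rw [ofAdd_add, map_mul, AlgEquiv.mul_apply]
          congr 1
          exact (g (.ofAdd k)).commutes _
      _ = ∑ i : ZMod p, φ (k - i) * g (.ofAdd i) θ :=
          Fintype.sum_equiv (Equiv.addLeft k) _ _ fun i ↦ by simp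
      _ = ∑ i : ZMod p, (φ (-i) * g (.ofAdd i) θ + φ k * g (.ofAdd i) θ) :=
          Finset.sum_congr rfl fun i _ ↦ by rw [← add_mul, ← map_add, neg_add_eq_sub]
      _ = y + φ k := by rw [Finset.sum_add_distrib, ← Finset.mul_sum, hsum, mul_one]
  refine ⟨y, ?_, ?_⟩
  · rintro ⟨x, hx⟩
    have h1 := hy 1
    rw [← hx, AlgEquiv.commutes, map_one] at h1
    exact one_ne_zero (left_eq_add.mp h1)
  · refine (IsGalois.mem_range_algebraMap_iff_fixed _).mpr fun σ ↦ ?_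
    obtain ⟨k, rfl⟩ := g.surjective σ
    have hk : g k y = y + φ (Multiplicative.toAdd k) := hy (Multiplicative.toAdd k)
    rw [map_sub, map_pow, hk, add_pow_char, ← map_pow, ZMod.pow_card]
    ring

theorem IntermediateField.exists_pow_mem_of_sup_eq_top {K E : Type*} [Field K] [Field E]
    [Algebra K E] (M F : IntermediateField K E) [IsGalois K M] [FiniteDimensional K M]
    [FiniteDimensional K F] (hsup : M ⊔ F = ⊤) {p : ℕ} (hp : p.Prime)
    (hM : Module.finrank K M = p) (hF : Module.finrank K F < p) {ζ : F}
    (hζ : IsPrimitiveRoot ζ p) : ∃ y : E, y ∉ F ∧ y ^ p ∈ F := by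
  have hgal : IsGalois F E := IsGalois.sup_right M F hsup
  have hfd : FiniteDimensional K E := by
    have : FiniteDimensional K (⊤ : IntermediateField K E) := hsup ▸ inferInstance
    exact IntermediateField.topEquiv.toLinearEquiv.finiteDimensional
  have hfd' : FiniteDimensional F E := FiniteDimensional.right K F E
  have hdvd : Module.finrank F E ∣ p := by
    rw [← hM, ← IsGalois.card_aut_eq_finrank F E, ← IsGalois.card_aut_eq_finrank K M]
    exact Subgroup.card_dvd_of_injective _ (restrictRestrictAlgEquivMapHom_injective M F hsup)
  have hone : Module.finrank F E ≠ 1 := by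
    intro h1
    have h2 := Module.finrank_mul_finrank K F E
    have h3 := Module.finrank_mul_finrank K M E
    rw [h1, mul_one] at h2
    rw [hM, ← h2] at h3
    exact absurd (Nat.le_of_dvd Module.finrank_pos ⟨_, h3.symm⟩) (not_le.mpr hF)
  have hE : Module.finrank F E = p := ((Nat.dvd_prime hp).mp hdvd).resolve_left hone
  have : Fact p.Prime := ⟨hp⟩
  have hcyc : IsCyclic Gal(E/F) :=
    isCyclic_of_prime_card (p := p) (by rw [IsGalois.card_aut_eq_finrank, hE])
  obtain ⟨y, ⟨b, hb⟩, hy⟩ := exists_root_adjoin_eq_top_of_isCyclic F E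
    (by rw [hE]; exact ⟨ζ, (mem_primitiveRoots hp.pos).mpr hζ⟩)
  rw [hE] at hb
  refine ⟨y, fun hyF ↦ hone ?_, hb ▸ b.2⟩
  have hbot : adjoin F {y} = ⊥ := adjoin_simple_eq_bot_iff.mpr (mem_bot.mpr ⟨⟨y, hyF⟩, rfl⟩)
  rw [← finrank_top', ← hy, hbot, IntermediateField.finrank_bot]

theorem IntermediateField.exists_pow_mem_of_finrank_lt {K Ω : Type*} [Field K] [Field Ω]
    [Algebra K Ω] (M F : IntermediateField K Ω) [IsGalois K M] [FiniteDimensional K M]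
    [FiniteDimensional K F] {p : ℕ} (hp : p.Prime)
    (hM : Module.finrank K M = p) (hF : Module.finrank K F < p) {ζ : F}
    (hζ : IsPrimitiveRoot ζ p) : ∃ y : Ω, y ∉ F ∧ y ^ p ∈ F := by
  let E := M ⊔ F
  let eM := restrictAlgEquiv (le_sup_left : M ≤ E)
  let eF := restrictAlgEquiv (le_sup_right : F ≤ E)
  have : IsGalois K (restrict (le_sup_left : M ≤ E)) := IsGalois.of_algEquiv eM
  have : FiniteDimensional K (restrict (le_sup_left : M ≤ E)) :=
    eM.toLinearEquiv.finiteDimensional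
  have : FiniteDimensional K (restrict (le_sup_right : F ≤ E)) :=
    eF.toLinearEquiv.finiteDimensional
  obtain ⟨y, hy, hyp⟩ := exists_pow_mem_of_sup_eq_top
    (restrict (le_sup_left : M ≤ E)) (restrict (le_sup_right : F ≤ E))
    (by rw [← lift_inj, lift_top, lift_sup, lift_restrict le_sup_left, lift_restrict le_sup_right])
    hp (eM.toLinearEquiv.finrank_eq ▸ hM) (eF.toLinearEquiv.finrank_eq ▸ hF)
    (hζ.map_of_injective eF.injective)
  exact ⟨y, fun h ↦ hy ((mem_restrict _ y).mpr h), (mem_restrict _ (y ^ p)).mp hyp⟩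

open Polynomial in
theorem mem_maxSolvableExt_of_aeval_eq_zero {K Ω : Type*} [Field K] [Field Ω] [Algebra K Ω]
    [IsAlgClosed Ω] {q : K[X]} (hq : q.Separable) [Group.IsSolvable q.Gal] {x : Ω}
    (hx : aeval x q = 0) : x ∈ maxSolvableExt K Ω := by
  have hsplit : (q.map (algebraMap K Ω)).Splits := IsAlgClosed.splits _
  have hL := IntermediateField.adjoin_rootSet_isSplittingField hsplit
  have : IsGalois K (IntermediateField.adjoin K (q.rootSet Ω)) :=
    IsGalois.of_separable_splitting_field hq
  have : FiniteDimensional K (IntermediateField.adjoin K (q.rootSet Ω)) :=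
    IsSplittingField.finiteDimensional _ q
  have hgal : Group.IsSolvable Gal(q.SplittingField/K) := ‹Group.IsSolvable q.Gal›
  let φ := (IsSplittingField.algEquiv (IntermediateField.adjoin K (q.rootSet Ω)) q).autCongr
  have hφ : Function.Injective φ.toMonoidHom := φ.injective
  have hsolv : Group.IsSolvable Gal(IntermediateField.adjoin K (q.rootSet Ω)/K) :=
    Group.isSolvable_of_isSolvable_injective hφ
  exact le_iSup (fun L : {L : IntermediateField K Ω // FiniteDimensional K L ∧ IsGalois K L ∧
    Group.IsSolvable Gal(L/K)} ↦ L.1) ⟨_, inferInstance, inferInstance, hsolv⟩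
    (IntermediateField.subset_adjoin K _
      ((mem_rootSet_of_ne hq.ne_zero).mpr hx))

instance maxSolvableExt.isGalois (K Ω : Type*) [Field K] [Field Ω] [Algebra K Ω] :
    IsGalois K (maxSolvableExt K Ω) := by
  have hgal : ∀ L : {L : IntermediateField K Ω // FiniteDimensional K L ∧ IsGalois K L ∧
    Group.IsSolvable Gal(L/K)}, IsGalois K L.1 := fun L ↦ L.2.2.1
  have h1 : Normal K (maxSolvableExt K Ω) :=
    IntermediateField.normal_iSup K Ω _ (h := fun L ↦ (hgal L).to_normal)
  have h2 : Algebra.IsSeparable K (maxSolvableExt K Ω) :=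
    IntermediateField.isSeparable_iSup K Ω (h := fun L ↦ (hgal L).to_isSeparable)
  exact isGalois_iff.mpr ⟨h2, h1⟩

theorem mem_maxSolvableExt_of_mem_solvableByRad {K Ω : Type*} [Field K] [Field Ω] [Algebra K Ω]
    [IsAlgClosed Ω] {x : Ω} (hx : x ∈ solvableByRad K Ω) (hsep : IsSeparable K x) :
    x ∈ maxSolvableExt K Ω := by
  have : Group.IsSolvable (minpoly K x).Gal := isSolvable_gal_minpoly hx
  exact mem_maxSolvableExt_of_aeval_eq_zero hsep (minpoly.aeval K x)

open Polynomial in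
theorem isSolvable_gal_X_pow_sub_X_sub_C {K : Type*} [Field K] {p : ℕ} [Fact p.Prime] [CharP K p]
    (d : K) : Group.IsSolvable (X ^ p - X - C d : K[X]).Gal := by
  have := charP_of_injective_algebraMap
    (algebraMap K (X ^ p - X - C d : K[X]).SplittingField).injective p
  have key : ∀ (σ : Gal((X ^ p - X - C d : K[X]).SplittingField/K)) {z : (X ^ p - X - C d : K[X]).SplittingField},
      z ^ p - z = algebraMap K _ d → ∃ c : K, σ z = z + algebraMap K _ c := fun σ z hz ↦ by
    obtain ⟨j, hj⟩ := ZMod.exists_castHom_eq_of_pow_eq ((algebraMap K _).comp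
      (ZMod.castHom dvd_rfl K)) (σ z - z) (by
        have := congrArg σ hz
        rw [σ.commutes, ← hz, map_sub, map_pow] at this
        rw [sub_pow_char]
        linear_combination this)
    exact ⟨_, (sub_eq_iff_eq_add'.mp hj.symm)⟩
  refine Group.isSolvable_of_comm fun (σ τ : Gal((X ^ p - X - C d : K[X]).SplittingField/K)) ↦
    Gal.ext _ fun z hz ↦ ?_
  have hz' : z ^ p - z = algebraMap K _ d := by
    have h0 := aeval_eq_zero_of_mem_rootSet hz
    simpa [sub_eq_zero] using h0
  obtain ⟨a, ha⟩ := key σ hz'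
  obtain ⟨b, hb⟩ := key τ hz'
  change σ (τ z) = τ (σ z)
  rw [ha, hb, map_add, map_add, ha, hb, σ.commutes, τ.commutes]
  ring

open Polynomial in
theorem mem_maxSolvableExt_of_pow_sub_self {K Ω : Type*} [Field K] [Field Ω] [Algebra K Ω]
    [IsAlgClosed Ω] {p : ℕ} [Fact p.Prime] [CharP K p] {d : K} {z : Ω}
    (hz : z ^ p - z = algebraMap K Ω d) : z ∈ maxSolvableExt K Ω := by
  have := isSolvable_gal_X_pow_sub_X_sub_C (p := p) d
  refine mem_maxSolvableExt_of_aeval_eq_zero (q := X ^ p - X - C d) ?_ (by simp [hz])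
  have hder : derivative (X ^ p - X - C d : K[X]) = -1 := by
    simp [derivative_X_pow]
  rw [Polynomial.separable_def, hder]
  exact isCoprime_one_right.neg_right

open IntermediateField in
theorem mem_maxSolvableExt_of_pow_mem_adjoin {K Ω : Type*} [Field K] [Field Ω] [Algebra K Ω]
    [IsAlgClosed Ω] [Algebra.IsAlgebraic K Ω] {n : ℕ} (hn : (n : K) ≠ 0) {ζ : Ω}
    (hζ : IsPrimitiveRoot ζ n) {z : Ω} (hz : z ^ n ∈ adjoin K {ζ}) (hz0 : z ≠ 0) :
    z ∈ maxSolvableExt K Ω := by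
  have hn0 : n ≠ 0 := fun h ↦ hn (by rw [h, Nat.cast_zero])
  have hζr : ζ ∈ solvableByRad K Ω := solvableByRad.rad_mem hn0
    (by rw [hζ.pow_eq_one]; exact one_mem _)
  have hsepζ : IsSeparable K ζ := by
    have h1 := Polynomial.separable_X_pow_sub_C (1 : K) hn one_ne_zero
    exact h1.of_dvd (minpoly.dvd K ζ (by simp [hζ.pow_eq_one]))
  have hr : z ∈ solvableByRad K Ω := solvableByRad.rad_mem hn0
    ((adjoin_simple_le_iff.mpr hζr) hz)
  refine mem_maxSolvableExt_of_mem_solvableByRad hr ?_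
  have hsep : Algebra.IsSeparable K (adjoin K {ζ}) :=
    (isSeparable_adjoin_simple_iff_isSeparable K Ω).mpr hsepζ
  refine IsSeparable.of_algebra_isSeparable_of_isSeparable (E := adjoin K {ζ}) K ?_
  have h1 := Polynomial.separable_X_pow_sub_C (⟨z ^ n, hz⟩ : adjoin K {ζ}) (n := n)
    (by exact_mod_cast (map_ne_zero (algebraMap K (adjoin K {ζ}))).mpr hn) (by
      simpa [Subtype.ext_iff] using fun h ↦ absurd h hz0)
  exact h1.of_dvd (minpoly.dvd _ z (by simp [IntermediateField.algebraMap_apply]))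

theorem mem_range_of_pow_sub_self_mem_range {K Ω : Type*} [Field K] [Field Ω] [Algebra K Ω]
    [IsGalois K Ω] {O₁ O₂ : ValuationSubring K} (h₁ : O₁ ≠ ⊤) (h₂ : O₂ ≠ ⊤)
    (hindep : O₁.toSubring ⊔ O₂.toSubring = ⊤) {V₁ V₂ : ValuationSubring Ω}
    (hV₁ : V₁.comap (algebraMap K Ω) = O₁) (hV₂ : V₂.comap (algebraMap K Ω) = O₂)
    (hv₁ : ∀ (σ : Gal(Ω/K)) (x : Ω), V₁.valuation x < 1 → V₁.valuation (σ x) < 1)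
    (hv₂ : ∀ (σ : Gal(Ω/K)) (x : Ω), V₂.valuation x < 1 → V₂.valuation (σ x) < 1)
    {p : ℕ} [Fact p.Prime] [CharP K p]
    (hroot : ∀ d : K, ∃ z : Ω, z ^ p - z = algebraMap K Ω d)
    {y : Ω} (hy : y ^ p - y ∈ Set.range (algebraMap K Ω)) : y ∈ Set.range (algebraMap K Ω) := by
  have : CharP Ω p := charP_of_injective_algebraMap (algebraMap K Ω).injective p
  have hprime : ∀ x : Ω, x ^ p = x → x ∈ Set.range (algebraMap K Ω) := fun x hx ↦ by
    obtain ⟨i, hi⟩ := ZMod.exists_castHom_eq_of_pow_eq ((algebraMap K Ω).comp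
      (ZMod.castHom dvd_rfl K)) x hx
    exact ⟨_, hi⟩
  obtain ⟨b, hb⟩ := hy
  rcases eq_or_ne b 0 with rfl | hb0
  · exact hprime y (by rw [map_zero] at hb; exact (sub_eq_zero.mp hb.symm))
  have hb' : algebraMap K Ω b ≠ 0 := by simpa using hb0
  obtain ⟨e, he₁, he₂⟩ := exists_approx_zero_one h₁ h₂ hindep hV₁ hV₂ (algebraMap K Ω b)⁻¹
    (algebraMap K Ω b)⁻¹ (inv_ne_zero hb') (inv_ne_zero hb')
  have hpos : ∀ V : ValuationSubring Ω, 0 < V.valuation (algebraMap K Ω b) := fun V ↦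
    zero_lt_iff.mpr ((Valuation.ne_zero_iff _).mpr hb')
  obtain ⟨z, hz⟩ := hroot (e * b)
  obtain ⟨w, hw⟩ := hroot ((1 - e) * b)
  obtain ⟨z', rfl⟩ := mem_range_of_pow_sub_self V₁.valuation hv₁ (by
    rwa [map_mul, map_mul, ← lt_div_iff₀ (hpos V₁), one_div, ← map_inv₀]) hz
  obtain ⟨w', rfl⟩ := mem_range_of_pow_sub_self V₂.valuation hv₂ (by
    rwa [map_mul, map_mul, map_sub, map_one, ← lt_div_iff₀ (hpos V₂), one_div, ← map_inv₀]) hw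
  obtain ⟨x, hx⟩ := hprime (y - algebraMap K Ω z' - algebraMap K Ω w') (by
    rw [sub_pow_char, sub_pow_char]
    simp only [map_mul, map_sub, map_one] at hz hw
    linear_combination -hb - hz - hw)
  exact ⟨x + z' + w', by rw [map_add, map_add, hx]; ring⟩

theorem mem_range_of_pow_mem_range {K F Ω : Type*} [Field K] [Field F] [Field Ω] [Algebra K F]
    [Algebra F Ω] [Algebra K Ω] [IsScalarTower K F Ω] [IsGalois K Ω]
    {O₁ O₂ : ValuationSubring K} (h₁ : O₁ ≠ ⊤) (h₂ : O₂ ≠ ⊤)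
    (hindep : O₁.toSubring ⊔ O₂.toSubring = ⊤) {V₁ V₂ : ValuationSubring Ω}
    (hV₁ : V₁.comap (algebraMap K Ω) = O₁) (hV₂ : V₂.comap (algebraMap K Ω) = O₂)
    (hv₁ : ∀ (σ : Gal(Ω/K)) (x : Ω), V₁.valuation x < 1 → V₁.valuation (σ x) < 1)
    (hv₂ : ∀ (σ : Gal(Ω/K)) (x : Ω), V₂.valuation x < 1 → V₂.valuation (σ x) < 1)
    {n : ℕ} (hn : (n : F) ≠ 0) {ζ : F} (hζ : IsPrimitiveRoot ζ n)
    (hroot : ∀ d : F, ∃ z : Ω, z ^ n = algebraMap F Ω d)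
    {y : Ω} (hy : y ^ n ∈ Set.range (algebraMap F Ω)) : y ∈ Set.range (algebraMap F Ω) := by
  have hgal : IsGalois F Ω := IsGalois.tower_top_of_isGalois K F Ω
  have hn0 : n ≠ 0 := fun h ↦ hn (by rw [h, Nat.cast_zero])
  have hnΩ : (n : Ω) ≠ 0 := by
    rw [← map_natCast (algebraMap F Ω)]
    exact (map_ne_zero _).mpr hn
  have : NeZero n := ⟨hn0⟩
  have hζ' : IsPrimitiveRoot (algebraMap F Ω ζ) n := hζ.map_of_injective (algebraMap F Ω).injective
  have hunity : ∀ η : Ω, η ^ n = 1 → η ∈ Set.range (algebraMap F Ω) := fun η hη ↦ by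
    obtain ⟨i, -, hi⟩ := hζ'.eq_pow_of_pow_eq_one hη
    exact ⟨ζ ^ i, by rw [map_pow, hi]⟩
  have hvn : ∀ V : ValuationSubring Ω, V.valuation (n : Ω) ≤ 1 := fun V ↦
    (V.valuation_le_one_iff _).mpr (natCast_mem V n)
  obtain ⟨a, ha⟩ := hy
  rcases eq_or_ne a 1 with rfl | ha1
  · exact hunity y (by rw [← ha, map_one])
  rcases eq_or_ne a 0 with rfl | ha0
  · exact ⟨0, by rw [map_zero, eq_comm, ← pow_eq_zero_iff hn0, ← ha, map_zero]⟩
  have ha0' : algebraMap F Ω a ≠ 0 := by simpa using ha0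
  have ha1' : 1 - algebraMap F Ω a ≠ 0 := by
    rw [← map_one (algebraMap F Ω), ← map_sub]
    exact (map_ne_zero _).mpr (sub_ne_zero.mpr ha1.symm)
  have hpos : ∀ (V : ValuationSubring Ω) {x : Ω}, x ≠ 0 → 0 < V.valuation x := fun V x hx ↦
    zero_lt_iff.mpr ((Valuation.ne_zero_iff _).mpr hx)
  obtain ⟨e, he₁, he₂⟩ := exists_approx_zero_one h₁ h₂ hindep hV₁ hV₂
    ((n : Ω) ^ n / ((1 - algebraMap F Ω a) / algebraMap F Ω a))
    ((n : Ω) ^ n / (1 - algebraMap F Ω a))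
    (div_ne_zero (pow_ne_zero _ hnΩ) (div_ne_zero ha1' ha0')) (div_ne_zero (pow_ne_zero _ hnΩ) ha1')
  rw [map_div₀, lt_div_iff₀ (hpos V₁ (div_ne_zero ha1' ha0')), ← map_mul, map_pow] at he₁
  rw [map_div₀, lt_div_iff₀ (hpos V₂ ha1'), ← map_mul, map_pow] at he₂
  rw [IsScalarTower.algebraMap_apply K F Ω] at he₁ he₂
  let c : F := a + algebraMap K F e * (1 - a)
  obtain ⟨z, hz⟩ := hroot (c / a)
  obtain ⟨w, hw⟩ := hroot c
  have hc₁ : V₁.valuation (algebraMap F Ω (c / a) - 1) < V₁.valuation (n : Ω) ^ n := by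
    convert he₁ using 2
    simp only [c, map_div₀, map_add, map_mul, map_sub, map_one]
    field_simp
    ring
  have hc₂ : V₂.valuation (algebraMap F Ω c - 1) < V₂.valuation (n : Ω) ^ n := by
    rw [Valuation.map_sub_swap]
    convert he₂ using 2
    simp only [c, map_add, map_mul, map_sub, map_one]
    ring
  have hc0 : c ≠ 0 := fun h ↦ by
    rw [h, map_zero, zero_sub, Valuation.map_neg, map_one] at hc₂
    exact absurd hc₂ (not_lt.mpr (pow_le_one' (hvn V₂) n))
  obtain ⟨z', rfl⟩ := mem_range_of_pow_eq (F := F) V₁.valuation (fun σ ↦ hv₁ (σ.restrictScalars K)) hn hζ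
    (hvn V₁) hc₁ hz
  obtain ⟨w', rfl⟩ := mem_range_of_pow_eq (F := F) V₂.valuation (fun σ ↦ hv₂ (σ.restrictScalars K)) hn hζ
    (hvn V₂) hc₂ hw
  have hw0 : algebraMap F Ω w' ≠ 0 := fun h ↦ by
    rw [h, zero_pow hn0, eq_comm, map_eq_zero] at hw
    exact hc0 hw
  have hc0' : algebraMap F Ω c ≠ 0 := by simpa using hc0
  obtain ⟨x, hx⟩ := hunity (y * algebraMap F Ω z' / algebraMap F Ω w') (by
    rw [div_pow, mul_pow, hz, hw, ← ha, map_div₀]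
    field_simp)
  have hz0 : algebraMap F Ω z' ≠ 0 := fun h ↦ by
    rw [h, zero_pow hn0, eq_comm, map_eq_zero] at hz
    exact div_ne_zero hc0 ha0 hz
  refine ⟨x * w' / z', ?_⟩
  rw [map_div₀, map_mul, hx]
  field_simp

theorem IsSolvHenselian.exists_valuationSubring {K : Type*} [Field K] {O : ValuationSubring K}
    (h : IsSolvHenselian O) : ∃ V : ValuationSubring (solvClosure K),
      V.comap (algebraMap K (solvClosure K)) = O ∧
      ∀ (σ : Gal(solvClosure K/K)) (x : solvClosure K),
        V.valuation x < 1 → V.valuation (σ x) < 1 := by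
  obtain ⟨V, hV, huniq⟩ := h
  refine ⟨V, hV, fun σ x hx ↦ ?_⟩
  have hσ : V.comap (σ : solvClosure K →+* solvClosure K) = V := huniq _ (by
    change (V.comap _).comap _ = O
    rw [← hV, ValuationSubring.comap_comap]
    congr 1
    ext x : 1
    exact σ.commutes x)
  rcases eq_or_ne x 0 with rfl | hx0
  · rwa [map_zero]
  by_contra! hcon
  refine absurd hx (not_lt.mpr ?_)
  have key : ∀ u : solvClosure K, u ≠ 0 → (1 ≤ V.valuation u ↔ u⁻¹ ∈ V) := fun u hu ↦ by
    rw [← V.valuation_le_one_iff, map_inv₀,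
      inv_le_one₀ (zero_lt_iff.mpr ((Valuation.ne_zero_iff _).mpr hu))]
  rw [key _ hx0, ← hσ]
  have h1 := (key _ ((map_ne_zero σ).mpr hx0)).mp hcon
  rw [← map_inv₀] at h1
  exact h1

open Polynomial in
theorem IsPrimitiveRoot.finrank_adjoin_lt {K E : Type*} [Field K] [Field E] [Algebra K E] {p : ℕ}
    (hp : p.Prime) {ζ : E} (hζ : IsPrimitiveRoot ζ p) :
    FiniteDimensional K (IntermediateField.adjoin K {ζ}) ∧
      Module.finrank K (IntermediateField.adjoin K {ζ}) < p := by
  have hroot : aeval ζ (cyclotomic p K) = 0 := by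
    have := hζ.isRoot_cyclotomic hp.pos
    rwa [← map_cyclotomic p (algebraMap K E), IsRoot.def, eval_map_algebraMap] at this
  have h_integral : IsIntegral K ζ := ⟨_, cyclotomic.monic p K, hroot⟩
  refine ⟨IntermediateField.adjoin.finiteDimensional h_integral, ?_⟩
  rw [IntermediateField.adjoin.finrank h_integral]
  calc (minpoly K ζ).natDegree ≤ (cyclotomic p K).natDegree :=
        natDegree_le_of_dvd (minpoly.dvd K ζ hroot) (cyclotomic_ne_zero p K)
    _ = p - 1 := by rw [natDegree_cyclotomic, Nat.totient_prime hp]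
    _ < p := Nat.sub_one_lt hp.ne_zero

/-- If `K` admits two nontrivial independent solv-henselian valuations,
then `K` is solv-closed. -/
theorem statement_9 (K : Type) [Field K] (O₁ O₂ : ValuationSubring K)
    (h1 : IsSolvHenselian O₁) (h2 : IsSolvHenselian O₂)
    (hnt1 : O₁ ≠ ⊤) (hnt2 : O₂ ≠ ⊤)
    (hindep : O₁.toSubring ⊔ O₂.toSubring = (⊤ : Subring K)) :
    IsSolvClosed K := by
  intro L hfd hgal hsolv
  replace hsolv : Group.IsSolvable Gal(L/K) := hsolv
  obtain ⟨V₁, hV₁, hv₁⟩ := h1.exists_valuationSubring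
  obtain ⟨V₂, hV₂, hv₂⟩ := h2.exists_valuationSubring
  by_contra hL
  have hnt : Nontrivial Gal(L/K) := by
    rw [← Finite.one_lt_card_iff_nontrivial, IsGalois.card_aut_eq_finrank]
    refine lt_of_le_of_ne Module.finrank_pos fun h ↦ hL ?_
    exact IntermediateField.finrank_eq_one_iff.mp h.symm
  obtain ⟨M', hM', hprime⟩ := IsGalois.exists_intermediateField_finrank_prime K L
  have hLΩ : L ≤ solvClosure K :=
    le_iSup (fun L : {L : IntermediateField K (AlgebraicClosure K) // FiniteDimensional K L ∧
      IsGalois K L ∧ Group.IsSolvable Gal(L/K)} ↦ L.1) ⟨L, hfd, hgal, hsolv⟩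
  let M : IntermediateField K (solvClosure K) := M'.map (IntermediateField.inclusion hLΩ)
  let eM : M' ≃ₐ[K] M := M'.equivMap (IntermediateField.inclusion hLΩ)
  have : IsGalois K M := IsGalois.of_algEquiv eM
  have : FiniteDimensional K M := eM.toLinearEquiv.finiteDimensional
  obtain ⟨p, hp⟩ : ∃ p, Module.finrank K M' = p := ⟨_, rfl⟩
  rw [hp] at hprime
  have hM : Module.finrank K M = p := eM.toLinearEquiv.finrank_eq ▸ hp
  have : Fact p.Prime := ⟨hprime⟩
  by_cases hpK : (p : K) = 0
  · have : CharP K p := (CharP.charP_iff_prime_eq_zero hprime).mpr hpK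
    obtain ⟨y, hyK, b, hb⟩ := IsGalois.exists_pow_sub_self_mem K M hM
    obtain ⟨x, hx⟩ := mem_range_of_pow_sub_self_mem_range hnt1 hnt2 hindep hV₁ hV₂ hv₁ hv₂ (p := p)
      (fun d ↦ by
        have hdeg : (Polynomial.X ^ p - Polynomial.X - Polynomial.C (algebraMap K _ d) :
            Polynomial (AlgebraicClosure K)).degree ≠ 0 := by
          have hpos : 0 < (Polynomial.X ^ p - Polynomial.X :
              Polynomial (AlgebraicClosure K)).degree := by
            rw [← Polynomial.natDegree_pos_iff_degree_pos,
              FiniteField.X_pow_card_sub_X_natDegree_eq _ hprime.one_lt]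
            exact hprime.pos
          rw [Polynomial.degree_sub_C hpos]
          exact hpos.ne'
        obtain ⟨z, hz⟩ := IsAlgClosed.exists_root _ hdeg
        have hz' : z ^ p - z = algebraMap K _ d := by simpa [sub_eq_zero] using hz
        exact ⟨⟨z, mem_maxSolvableExt_of_pow_sub_self hz'⟩, Subtype.ext hz'⟩)
      (y := (y : solvClosure K)) ⟨b, congrArg (algebraMap M (solvClosure K)) hb⟩
    exact hyK ⟨x, Subtype.ext hx⟩
  · have : NeZero (p : AlgebraicClosure K) := ⟨by
      rw [← map_natCast (algebraMap K (AlgebraicClosure K))]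
      exact (map_ne_zero _).mpr hpK⟩
    obtain ⟨ζ, hζ⟩ := HasEnoughRootsOfUnity.exists_primitiveRoot (AlgebraicClosure K) p
    have hmem : ∀ z : AlgebraicClosure K, z ^ p ∈ IntermediateField.adjoin K {ζ} →
        z ∈ solvClosure K := fun z hz ↦ by
      rcases eq_or_ne z 0 with rfl | hz0
      · exact zero_mem _
      · exact mem_maxSolvableExt_of_pow_mem_adjoin hpK hζ hz hz0
    let ζ' : solvClosure K := ⟨ζ, hmem ζ (by rw [hζ.pow_eq_one]; exact one_mem _)⟩
    have hζ' : IsPrimitiveRoot ζ' p :=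
      hζ.of_map_of_injective (f := (solvClosure K).val) Subtype.val_injective
    let F := IntermediateField.adjoin K {ζ'}
    obtain ⟨hFfd, hF⟩ := hζ'.finrank_adjoin_lt (K := K) hprime
    have hζF : IsPrimitiveRoot (⟨ζ', IntermediateField.mem_adjoin_simple_self K ζ'⟩ : F) p :=
      hζ'.of_map_of_injective (f := F.val) Subtype.val_injective
    obtain ⟨y, hyF, hy⟩ := IntermediateField.exists_pow_mem_of_finrank_lt M F hprime hM hF hζF
    obtain ⟨x, rfl⟩ := mem_range_of_pow_mem_range (F := F) hnt1 hnt2 hindep hV₁ hV₂ hv₁ hv₂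
      (n := p) (by
        rw [← map_natCast (algebraMap K F)]
        exact (map_ne_zero _).mpr hpK) hζF
      (fun d ↦ by
        obtain ⟨z, hz⟩ := IsAlgClosed.exists_pow_nat_eq
          ((d : solvClosure K) : AlgebraicClosure K) hprime.pos
        refine ⟨⟨z, hmem z ?_⟩, Subtype.ext hz⟩
        rw [hz, ← IntermediateField.lift_adjoin_simple K (solvClosure K) ζ']
        exact (IntermediateField.mem_lift _).mpr d.2)
      (y := y) ⟨⟨_, hy⟩, rfl⟩
    exact hyF x.2
end
end

section
/- Let K be a field. If the maximal solvable extension K^solv is a finite extension of K, then [K^solv : K] ≤ 2. -/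
noncomputable section

namespace SolvClosure

open IntermediateField Polynomial

section Solvable

variable {K Ω : Type*} [Field K] [Field Ω] [Algebra K Ω]

theorem isSolvable_iff_derivedSeries_le_fixingSubgroup [Normal K Ω] (E : IntermediateField K Ω)
    [Normal K E] :
    Group.IsSolvable (E ≃ₐ[K] E) ↔ ∃ n, derivedSeries (Ω ≃ₐ[K] Ω) n ≤ E.fixingSubgroup := by
  rw [Group.isSolvable_def]
  refine exists_congr fun n ↦ ?_
  rw [← map_derivedSeries_eq (AlgEquiv.restrictNormalHom_surjective (F := K) (K₁ := E) Ω),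
    Subgroup.map_eq_bot_iff, restrictNormalHom_ker]

/-- Finite Galois subextensions with solvable Galois group. -/
def IsSolvGalois (E : IntermediateField K Ω) : Prop :=
  FiniteDimensional K E ∧ IsGalois K E ∧ Group.IsSolvable (E ≃ₐ[K] E)

theorem IsSolvGalois.le_maxSolvableExt {E : IntermediateField K Ω} (h : IsSolvGalois E) :
    E ≤ maxSolvableExt K Ω :=
  le_iSup (fun L : {L : IntermediateField K Ω //
      FiniteDimensional K ↥L ∧ IsGalois K ↥L ∧ Group.IsSolvable (↥L ≃ₐ[K] ↥L)} ↦ L.1) ⟨E, h⟩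

theorem isSolvGalois_bot : IsSolvGalois (⊥ : IntermediateField K Ω) := by
  refine ⟨inferInstance, inferInstance, ?_⟩
  have : Subsingleton ((⊥ : IntermediateField K Ω) ≃ₐ[K] (⊥ : IntermediateField K Ω)) := by
    refine ⟨fun σ τ ↦ AlgEquiv.ext fun x ↦ ?_⟩
    obtain ⟨y, hy⟩ := mem_bot.1 x.2
    obtain rfl : algebraMap K (⊥ : IntermediateField K Ω) y = x := Subtype.ext hy
    simp
  infer_instance

theorem IsSolvGalois.sup [Normal K Ω] {E E' : IntermediateField K Ω} (h : IsSolvGalois E)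
    (h' : IsSolvGalois E') : IsSolvGalois (E ⊔ E') := by
  obtain ⟨_, _, hs⟩ := h
  obtain ⟨_, _, hs'⟩ := h'
  refine ⟨inferInstance, inferInstance, ?_⟩
  rw [isSolvable_iff_derivedSeries_le_fixingSubgroup] at hs hs' ⊢
  obtain ⟨n, hn⟩ := hs
  obtain ⟨m, hm⟩ := hs'
  refine ⟨max n m, ?_⟩
  rw [fixingSubgroup_sup]
  exact le_inf ((derivedSeries_antitone _ (le_max_left n m)).trans hn)
    ((derivedSeries_antitone _ (le_max_right n m)).trans hm)

theorem isSolvGalois_maxSolvableExt [Normal K Ω] (h : FiniteDimensional K (maxSolvableExt K Ω)) :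
    IsSolvGalois (maxSolvableExt K Ω) := by
  have hle (E : IntermediateField K Ω) (hE : IsSolvGalois E) :
      Module.finrank K E ≤ Module.finrank K (maxSolvableExt K Ω) :=
    finrank_le_of_le_right hE.le_maxSolvableExt
  have hbdd : BddAbove ((fun E : IntermediateField K Ω ↦ Module.finrank K E) ''
      {E | IsSolvGalois E}) :=
    ⟨_, by rintro _ ⟨E, hE, rfl⟩; exact hle E hE⟩
  obtain ⟨E, hE, hmax⟩ := Nat.sSup_mem (Set.Nonempty.image _ ⟨⊥, isSolvGalois_bot⟩) hbdd
  suffices maxSolvableExt K Ω = E from this ▸ hE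
  refine le_antisymm (iSup_le fun ⟨E', hE'⟩ ↦ ?_) hE.le_maxSolvableExt
  have hs : IsSolvGalois (E ⊔ E') := IsSolvGalois.sup hE hE'
  have := hs.1
  have hrank : Module.finrank K (E ⊔ E' : IntermediateField K Ω) ≤ Module.finrank K E := by
    have := le_csSup hbdd ⟨_, hs, rfl⟩
    exact this.trans_eq hmax.symm
  exact le_sup_right.trans_eq (eq_of_le_of_finrank_le le_sup_left hrank).symm

/-- If the automorphisms over a solvable extension commute on the roots of `q`, then these roots
lie in the maximal solvable extension. -/
theorem mem_maxSolvableExt_of_commute [Normal K Ω] {L : IntermediateField K Ω}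
    (hL : IsSolvGalois L) {q : K[X]} (hq : (q.map (algebraMap K Ω)).Splits)
    (hsep : ∀ β ∈ q.rootSet Ω, IsSeparable K β)
    (hcomm : ∀ σ ∈ L.fixingSubgroup, ∀ τ ∈ L.fixingSubgroup, ∀ β ∈ q.rootSet Ω,
      σ (τ β) = τ (σ β)) {β : Ω} (hβ : β ∈ q.rootSet Ω) : β ∈ maxSolvableExt K Ω := by
  obtain ⟨_, _, hs⟩ := hL
  let R := adjoin K (q.rootSet Ω)
  have hsplit : q.IsSplittingField K R := adjoin_rootSet_isSplittingField hq
  have : Normal K R := Normal.of_isSplittingField q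
  have : FiniteDimensional K R := hsplit.finiteDimensional
  have : Algebra.IsSeparable K R := (isSeparable_adjoin_iff_isSeparable K Ω).2 hsep
  have : IsGalois K R := { }
  have hgood : IsSolvGalois (L ⊔ R) := by
    refine ⟨inferInstance, inferInstance, ?_⟩
    rw [isSolvable_iff_derivedSeries_le_fixingSubgroup] at hs ⊢
    obtain ⟨n, hn⟩ := hs
    refine ⟨n + 1, ?_⟩
    rw [derivedSeries_succ, fixingSubgroup_sup]
    refine le_inf ((Subgroup.commutator_le_left _ _).trans hn)
      (Subgroup.commutator_le.2 fun σ hσ τ hτ ↦ ?_)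
    have hadj : R ≤ fixedField (Subgroup.zpowers (σ * τ * σ⁻¹ * τ⁻¹)) := by
      refine adjoin_le_iff.2 fun γ hγ ↦ ?_
      have hfix : (σ * τ * σ⁻¹ * τ⁻¹) • γ = γ := by
        have := hcomm σ⁻¹ (inv_mem (hn hσ)) τ⁻¹ (inv_mem (hn hτ)) γ hγ
        simp only [mul_smul, AlgEquiv.smul_def, this]
        simp [AlgEquiv.aut_inv]
      rw [SetLike.mem_coe, mem_fixedField_iff]
      exact fun g hg ↦ MulAction.mem_stabilizer_iff.1 (Subgroup.zpowers_le.2 hfix hg)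
    exact (le_iff_le _ _).1 hadj (Subgroup.mem_zpowers _)
  exact hgood.le_maxSolvableExt (le_sup_right (a := L) (subset_adjoin K _ hβ))

end Solvable

theorem mem_range_algebraMap_of_pow_char_eq (K : Type*) {L : Type*} [Field K] [Field L]
    [Algebra K L] {p : ℕ} [Fact p.Prime] [CharP L p] {c : L} (hc : c ^ p = c) :
    ∃ a : K, algebraMap K L a = c :=
  (bot_le : (⊥ : Subfield L) ≤ (algebraMap K L).fieldRange)
    ((Subfield.mem_bot_iff_pow_eq_self L p).2 hc)

section Closed

variable {K Ω : Type*} [Field K] [Field Ω] [Algebra K Ω]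

theorem mem_maxSolvableExt_of_pow_eq_one [Normal K Ω] [IsAlgClosed Ω] {n : ℕ} (hn : (n : K) ≠ 0)
    {β : Ω} (hβ : β ^ n = 1) : β ∈ maxSolvableExt K Ω := by
  have hn0 : n ≠ 0 := by rintro rfl; simp at hn
  have : NeZero n := ⟨hn0⟩
  have hq0 : (X ^ n - C (1 : K)) ≠ 0 := X_pow_sub_C_ne_zero (Nat.pos_of_ne_zero hn0) 1
  have hmem (γ : Ω) : γ ∈ (X ^ n - C (1 : K)).rootSet Ω ↔ γ ^ n = 1 := by
    rw [mem_rootSet, and_iff_right hq0]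
    simp [sub_eq_zero]
  refine mem_maxSolvableExt_of_commute (q := X ^ n - C (1 : K)) isSolvGalois_bot
    (IsAlgClosed.splits _) (fun γ hγ ↦ ?_) (fun σ _ τ _ γ hγ ↦ ?_) ((hmem β).2 hβ)
  · exact (separable_X_pow_sub_C (1 : K) hn one_ne_zero).of_dvd
      (minpoly.dvd _ _ (mem_rootSet.1 hγ).2)
  · rw [hmem] at hγ
    have hpow (g : Ω ≃ₐ[K] Ω) : ∃ m, g γ = γ ^ m :=
      map_rootsOfUnity_eq_pow_self g (rootsOfUnity.mkOfPowEq γ hγ)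
    obtain ⟨a, ha⟩ := hpow σ
    obtain ⟨b, hb⟩ := hpow τ
    rw [hb, map_pow, ha, map_pow, hb, ← pow_mul, ← pow_mul, mul_comm]

theorem mem_maxSolvableExt_of_aeval_mem [Normal K Ω] [IsAlgClosed Ω]
    (hL : IsSolvGalois (maxSolvableExt K Ω)) {g : K[X]}
    (hsep : ∀ β : Ω, aeval β g ≠ 0 → aeval β g ∈ maxSolvableExt K Ω →
      IsSeparable (maxSolvableExt K Ω) β)
    (hcomm : ∀ σ ∈ (maxSolvableExt K Ω).fixingSubgroup, ∀ τ ∈ (maxSolvableExt K Ω).fixingSubgroup,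
      ∀ β : Ω, aeval β g ≠ 0 → aeval β g ∈ maxSolvableExt K Ω → σ (τ β) = τ (σ β))
    (hg : g.natDegree ≠ 0) {β : Ω} (h0 : aeval β g ≠ 0) (hβ : aeval β g ∈ maxSolvableExt K Ω) :
    β ∈ maxSolvableExt K Ω := by
  have := hL.1
  have := hL.2.1
  set L := maxSolvableExt K Ω
  set x : Ω := aeval β g
  have hint : IsIntegral K x := Normal.isIntegral ‹_› x
  have hm0 : (minpoly K x).comp g ≠ 0 := by
    refine fun h ↦ (minpoly.natDegree_pos hint).ne' ?_
    have h1 := congrArg natDegree h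
    rw [natDegree_comp, natDegree_zero] at h1
    exact (mul_eq_zero.1 h1).resolve_right hg
  have hroot (γ : Ω) (hγ : γ ∈ ((minpoly K x).comp g).rootSet Ω) :
      aeval γ g ≠ 0 ∧ aeval γ g ∈ L := by
    have h1 : aeval (aeval γ g) (minpoly K x) = 0 := by
      rw [← aeval_comp]; exact (mem_rootSet.1 hγ).2
    obtain ⟨σ, hσ⟩ := minpoly.exists_algEquiv_of_root' hint.isAlgebraic h1
    rw [← hσ]
    exact ⟨(_root_.map_ne_zero σ).2 h0, σ.restrictNormal_commutes L ⟨x, hβ⟩ ▸ SetLike.coe_mem _⟩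
  refine mem_maxSolvableExt_of_commute (q := (minpoly K x).comp g) hL (IsAlgClosed.splits _)
    (fun γ hγ ↦ ?_) (fun σ hσ τ hτ γ hγ ↦ ?_) ?_
  · exact IsSeparable.of_algebra_isSeparable_of_isSeparable K
      (hsep γ (hroot γ hγ).1 (hroot γ hγ).2)
  · exact hcomm σ hσ τ hτ γ (hroot γ hγ).1 (hroot γ hγ).2
  · refine mem_rootSet.2 ⟨hm0, ?_⟩
    rw [aeval_comp, minpoly.aeval]

theorem mem_maxSolvableExt_of_pow_mem [Normal K Ω] [IsAlgClosed Ω]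
    (hL : IsSolvGalois (maxSolvableExt K Ω)) {n : ℕ} (hn : (n : K) ≠ 0) {β : Ω}
    (hβ : β ^ n ∈ maxSolvableExt K Ω) : β ∈ maxSolvableExt K Ω := by
  have hn0 : n ≠ 0 := by rintro rfl; simp at hn
  rcases eq_or_ne β 0 with rfl | hβ0
  · exact zero_mem _
  refine mem_maxSolvableExt_of_aeval_mem hL (g := X ^ n) (fun γ h0 hγ ↦ ?_)
    (fun σ hσ τ hτ γ h0 hγ ↦ ?_) (by simpa) (by simp [hβ0]) (by simpa)
  · simp only [map_pow, aeval_X] at h0 hγ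
    have hn' : (n : maxSolvableExt K Ω) ≠ 0 := by
      rw [← map_natCast (algebraMap K _)]
      exact (_root_.map_ne_zero _).2 hn
    have h0' : (⟨γ ^ n, hγ⟩ : maxSolvableExt K Ω) ≠ 0 := fun h ↦ h0 (congrArg Subtype.val h)
    refine (separable_X_pow_sub_C _ hn' h0').of_dvd (minpoly.dvd _ _ ?_)
    simp [IntermediateField.algebraMap_apply]
  · simp only [map_pow, aeval_X] at h0 hγ
    have hγ0 : γ ≠ 0 := by rintro rfl; simp [hn0] at h0
    have key : ∀ ρ ∈ (maxSolvableExt K Ω).fixingSubgroup,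
        ∃ ζ ∈ maxSolvableExt K Ω, ρ γ = ζ * γ := by
      intro ρ hρ
      refine ⟨ρ γ / γ, mem_maxSolvableExt_of_pow_eq_one hn ?_, by field_simp⟩
      rw [div_pow, ← map_pow, (mem_fixingSubgroup_iff _ _).1 hρ _ hγ, div_self h0]
    obtain ⟨a, ha, hσa⟩ := key σ hσ
    obtain ⟨b, hb, hτb⟩ := key τ hτ
    rw [hσa, hτb, map_mul, map_mul, hσa, hτb, (mem_fixingSubgroup_iff _ _).1 hσ _ hb,
      (mem_fixingSubgroup_iff _ _).1 hτ _ ha]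
    ring

theorem mem_maxSolvableExt_of_pow_sub_mem [Normal K Ω] [IsAlgClosed Ω]
    (hL : IsSolvGalois (maxSolvableExt K Ω)) {p : ℕ} [hp : Fact p.Prime] [CharP K p] {β : Ω}
    (h0 : β ^ p - β ≠ 0) (hβ : β ^ p - β ∈ maxSolvableExt K Ω) : β ∈ maxSolvableExt K Ω := by
  have : CharP Ω p := charP_of_injective_algebraMap (algebraMap K Ω).injective p
  have : CharP (maxSolvableExt K Ω) p := charP_of_injective_algebraMap (algebraMap K _).injective p
  refine mem_maxSolvableExt_of_aeval_mem hL (g := X ^ p - X) (fun γ h0 hγ ↦ ?_)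
    (fun σ hσ τ hτ γ h0 hγ ↦ ?_) ?_ (by simpa) (by simpa)
  · simp only [map_pow, aeval_X, map_sub] at h0 hγ
    have hs : (X ^ p - X - C (⟨γ ^ p - γ, hγ⟩ : maxSolvableExt K Ω)).Separable := by
      rw [separable_def]
      have : derivative (X ^ p - X - C (⟨γ ^ p - γ, hγ⟩ : maxSolvableExt K Ω)) = -1 := by
        simp [derivative_X_pow]
      rw [this]
      exact isCoprime_one_right.neg_right
    refine hs.of_dvd (minpoly.dvd _ _ ?_)
    simp [IntermediateField.algebraMap_apply]
  · simp only [map_pow, aeval_X, map_sub] at h0 hγ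
    have key : ∀ ρ ∈ (maxSolvableExt K Ω).fixingSubgroup,
        ∃ c : Ω, (∀ π : Ω ≃ₐ[K] Ω, π c = c) ∧ ρ γ = c + γ := by
      intro ρ hρ
      refine ⟨ρ γ - γ, fun π ↦ ?_, by ring⟩
      have h1 : (ρ γ - γ) ^ p = ρ γ - γ := by
        have := (mem_fixingSubgroup_iff _ _).1 hρ _ hγ
        simp only [map_sub, map_pow] at this
        rw [sub_pow_char]
        linear_combination this
      obtain ⟨k, hk⟩ := mem_range_algebraMap_of_pow_char_eq K h1
      rw [← hk, AlgEquiv.commutes]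
    obtain ⟨a, ha, hσa⟩ := key σ hσ
    obtain ⟨b, hb, hτb⟩ := key τ hτ
    rw [hσa, hτb, map_add, map_add, hσa, hτb, ha, hb]
    ring
  · rw [natDegree_sub_eq_left_of_natDegree_lt] <;> simp [hp.out.ne_zero, hp.out.one_lt]

end Closed

section PrimeDegree

open Module

variable {F L : Type} [Field F] [Field L] [Algebra F L] [FiniteDimensional F L] [IsGalois F L]

theorem exists_generator_of_finrank_prime {p : ℕ} [hp : Fact p.Prime] (hd : finrank F L = p) :
    ∃ σ : L ≃ₐ[F] L, σ ^ p = 1 ∧ σ ≠ 1 ∧ ∀ τ, τ ∈ Subgroup.zpowers σ := by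
  have hcard : Nat.card (L ≃ₐ[F] L) = p := by rw [IsGalois.card_aut_eq_finrank, hd]
  have := isCyclic_of_prime_card hcard
  obtain ⟨σ, hσ⟩ := IsCyclic.exists_generator (α := L ≃ₐ[F] L)
  refine ⟨σ, by rw [← hcard, pow_card_eq_one'], ?_, hσ⟩
  rintro rfl
  have h1 := orderOf_eq_card_of_forall_mem_zpowers hσ
  rw [orderOf_one, hcard] at h1
  exact hp.out.one_lt.ne h1

theorem mem_range_algebraMap_of_generator {σ : L ≃ₐ[F] L} (hσ : ∀ τ, τ ∈ Subgroup.zpowers σ)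
    {x : L} (hx : σ x = x) : ∃ a : F, algebraMap F L a = x := by
  refine IntermediateField.mem_bot.1 ((IsGalois.mem_bot_iff_fixed x).2 fun τ ↦ ?_)
  have hle : Subgroup.zpowers σ ≤ MulAction.stabilizer _ x := Subgroup.zpowers_le.2 hx
  exact MulAction.mem_stabilizer_iff.1 (hle (hσ τ))

/-- A field with surjective Artin–Schreier map is not of degree `p` over a subfield over which it
is Galois. -/
theorem finrank_ne_char {p : ℕ} [hp : Fact p.Prime] [CharP L p]
    (hAS : ∀ x : L, ∃ y, y ^ p - y = x) : finrank F L ≠ p := by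
  intro hd
  obtain ⟨σ, hσp, hσ1, hσ⟩ := exists_generator_of_finrank_prime hd
  have : CharP F p := (algebraMap F L).charP (algebraMap F L).injective p
  let D : Module.End F L := σ.toLinearMap - 1
  have hD (x : L) : D x = σ x - x := rfl
  have hDp : D ^ p = 0 := by
    have : CharP (Module.End F L) p :=
      charP_of_injective_algebraMap (FaithfulSMul.algebraMap_injective F (Module.End F L)) p
    have h1 : ∀ n : ℕ, ∀ x, (σ.toLinearMap ^ n) x = (σ ^ n) x := by
      intro n
      induction n with
      | zero => simp
      | succ n ih => intro x; rw [pow_succ, pow_succ, Module.End.mul_apply, ih]; rfl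
    rw [sub_pow_char_of_commute _ (Commute.one_right _), one_pow, sub_eq_zero]
    ext x
    rw [h1, hσp]
    rfl
  have hD0 : D ≠ 0 := fun h ↦ hσ1 (AlgEquiv.ext fun x ↦ sub_eq_zero.1 (by
    rw [AlgEquiv.one_apply, ← hD, h, LinearMap.zero_apply]))
  obtain ⟨α, hα⟩ : ∃ α, σ α = α + 1 := by
    classical
    have hex : ∃ n, D ^ n = 0 := ⟨p, hDp⟩
    obtain ⟨n, hn⟩ : ∃ n, Nat.find hex = n + 2 := by
      refine Nat.exists_eq_add_of_le' ?_
      by_contra! hlt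
      have hspec := Nat.find_spec hex
      interval_cases Nat.find hex
      · exact one_ne_zero ((pow_zero D).symm.trans hspec)
      · exact hD0 ((pow_one D).symm.trans hspec)
    have hn0 : D ^ (n + 2) = 0 := hn ▸ Nat.find_spec hex
    have hn1 : D ^ (n + 1) ≠ 0 := Nat.find_min hex (by omega)
    obtain ⟨x, hx⟩ : ∃ x, (D ^ (n + 1)) x ≠ 0 := by
      by_contra! h
      exact hn1 (LinearMap.ext h)
    rw [pow_succ', Module.End.mul_apply] at hx
    have hDD : D (D ((D ^ n) x)) = 0 := by
      rw [← Module.End.mul_apply, ← Module.End.mul_apply, mul_assoc, ← pow_succ', ← pow_succ',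
        hn0, LinearMap.zero_apply]
    set y := (D ^ n) x
    refine ⟨y / D y, ?_⟩
    have h1 : σ (D y) = D y := sub_eq_zero.1 hDD
    rw [map_div₀, h1, eq_add_of_sub_eq' (hD y).symm]
    field_simp
  have hfix : σ (α ^ p - α) = α ^ p - α := by
    rw [map_sub, map_pow, hα, add_pow_char]
    ring
  obtain ⟨a, ha⟩ := mem_range_algebraMap_of_generator hσ hfix
  obtain ⟨θ, hθ⟩ := Algebra.trace_surjective F L a
  obtain ⟨y, hy⟩ := hAS θ
  have htr : algebraMap F L (Algebra.trace F L y) ^ p - algebraMap F L (Algebra.trace F L y)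
      = algebraMap F L a := by
    rw [← hθ, ← hy, trace_eq_sum_automorphisms, trace_eq_sum_automorphisms, sum_pow_char,
      ← Finset.sum_sub_distrib]
    simp
  set t := Algebra.trace F L y
  have h1 : (α - algebraMap F L t) ^ p = α - algebraMap F L t := by
    rw [sub_pow_char]
    linear_combination -htr - ha
  have h2 : σ (α - algebraMap F L t) = α - algebraMap F L t := by
    obtain ⟨b, hb⟩ := mem_range_algebraMap_of_pow_char_eq F h1
    rw [← hb, AlgEquiv.commutes]
  rw [map_sub, hα, AlgEquiv.commutes] at h2
  exact one_ne_zero (α := L) (by linear_combination h2)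

theorem finrank_ne_of_primitiveRoot {p : ℕ} [hp : Fact p.Prime] {i : F} (hi : i ^ 2 = -1) {ζ : L}
    (hζ : IsPrimitiveRoot ζ p) (hroot : ∀ x : L, ∃ y, y ^ p = x) : finrank F L ≠ p := by
  intro hd
  obtain ⟨σ, hσp, -, hσ⟩ := exists_generator_of_finrank_prime hd
  have hp0 : p ≠ 0 := hp.out.ne_zero
  have : NeZero p := ⟨hp0⟩
  have hσζ : σ ζ = ζ := by
    obtain ⟨m, -, hm⟩ := hζ.eq_pow_of_pow_eq_one (ξ := σ ζ) (by
      rw [← map_pow, hζ.pow_eq_one, map_one])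
    have hiter : ∀ n : ℕ, (σ ^ n) ζ = ζ ^ (m ^ n) := by
      intro n
      induction n with
      | zero => simp
      | succ n ih => rw [pow_succ', AlgEquiv.mul_apply, ih, map_pow, ← hm, ← pow_mul, pow_succ']
    have h1 := hiter p
    rw [hσp, AlgEquiv.one_apply] at h1
    have h2 : m ^ p ≡ m [MOD p] := by
      rw [← ZMod.natCast_eq_natCast_iff, Nat.cast_pow, ZMod.pow_card]
    have h3 : ζ ^ (m ^ p) = ζ ^ m := by
      rw [← pow_mod_orderOf, ← pow_mod_orderOf ζ m, ← hζ.eq_orderOf, h2]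
    rw [← hm, ← h3, ← h1]
  have : IsCyclic (L ≃ₐ[F] L) := ⟨σ, hσ⟩
  obtain ⟨z, hz⟩ := mem_range_algebraMap_of_generator hσ hσζ
  obtain ⟨α, hα⟩ := groupCohomology.exists_div_of_norm_eq_one hσ (x := ζ⁻¹) (by
    rw [← hz, ← map_inv₀, Algebra.norm_algebraMap, hd, inv_pow, inv_eq_one]
    exact (algebraMap F L).injective (by rw [map_pow, hz, hζ.pow_eq_one, map_one]))
  obtain ⟨β, hβ⟩ := hroot α
  have hβ0 : β ≠ 0 := by
    rintro rfl
    exact α.ne_zero (by rw [← hβ, zero_pow hp0])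
  have hσα : σ α = ζ * α := by
    have : σ (α : L) ≠ 0 := by simp
    have := hζ.ne_zero hp0
    field_simp at hα
    rw [← hα, mul_comm]
  obtain ⟨ω, hω⟩ : ∃ ω, σ β = ω * β := ⟨σ β / β, by field_simp⟩
  have hωp : ω ^ p = ζ := by
    have : (ω * β) ^ p = ζ * β ^ p := by rw [← hω, ← map_pow, hβ, hσα]
    rw [mul_pow] at this
    exact mul_right_cancel₀ (pow_ne_zero p hβ0) this
  have hω0 : ω ≠ 0 := by
    rintro rfl
    exact hζ.ne_zero hp0 (by rw [← hωp, zero_pow hp0])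
  obtain ⟨k, hk, hkp⟩ : ∃ k : ℕ, σ ω = ω * ζ ^ k ∧ p ∣ k * p.choose 2 := by
    rcases hp.out.eq_two_or_odd' with rfl | hodd
    · refine ⟨0, ?_, by simp⟩
      have h1 : ζ = -1 := hζ.eq_neg_one_of_two_right
      have h2 : ω ^ 2 = algebraMap F L i ^ 2 := by rw [hωp, h1, ← map_pow, hi, map_neg, map_one]
      rcases sq_eq_sq_iff_eq_or_eq_neg.1 h2 with rfl | rfl <;> simp
    · obtain ⟨k, -, hk⟩ := hζ.eq_pow_of_pow_eq_one (ξ := σ ω / ω) (by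
        rw [div_pow, ← map_pow, hωp, hσζ, div_self (hζ.ne_zero hp0)])
      refine ⟨k, by rw [hk]; field_simp, ?_⟩
      refine Dvd.dvd.mul_left (hp.out.dvd_choose_self two_ne_zero ?_) k
      have := hp.out.two_le
      have : p ≠ 2 := by rintro rfl; exact absurd hodd (by decide)
      omega
  have hiter : ∀ n : ℕ, (σ ^ n) β = ω ^ n * ζ ^ (k * n.choose 2) * β := by
    intro n
    induction n with
    | zero => simp
    | succ n ih =>
      rw [pow_succ', AlgEquiv.mul_apply, ih, map_mul, map_mul, map_pow, map_pow, hσζ, hω, hk,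
        Nat.choose_succ_succ' n 1, Nat.choose_one_right, mul_add, pow_add, mul_pow, ← pow_mul]
      ring
  have h1 := hiter p
  rw [hσp, AlgEquiv.one_apply, hωp, (hζ.pow_eq_one_iff_dvd _).2 hkp, mul_one] at h1
  have h2 : ζ = 1 := mul_right_cancel₀ hβ0 (by rw [← h1, one_mul])
  exact hζ.ne_one hp.out.one_lt h2

end PrimeDegree

/-- The maximal solvable extension, if finite, is not of prime degree over an intermediate field
containing a square root of `-1`. -/
theorem finrank_ne_prime {K : Type} [Field K] (h : FiniteDimensional K (solvClosure K))
    {F : Type} [Field F] [Algebra F (solvClosure K)] [FiniteDimensional F (solvClosure K)]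
    [IsGalois F (solvClosure K)] {i : F} (hi : i ^ 2 = -1) {p : ℕ} (hp : p.Prime) :
    Module.finrank F (solvClosure K) ≠ p := by
  have : Fact p.Prime := ⟨hp⟩
  have hL := isSolvGalois_maxSolvableExt h
  by_cases hpK : (p : K) = 0
  · have : CharP K p := (CharP.charP_iff_prime_eq_zero hp).2 hpK
    have : CharP (solvClosure K) p :=
      charP_of_injective_algebraMap (algebraMap K (solvClosure K)).injective p
    refine finrank_ne_char fun x ↦ ?_
    rcases eq_or_ne x 0 with rfl | hx
    · exact ⟨0, by simp [hp.ne_zero]⟩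
    obtain ⟨β, hβ⟩ := IsAlgClosed.exists_aeval_eq_zero (AlgebraicClosure K)
      (X ^ p - X - C x : (solvClosure K)[X]) (by
        rw [sub_sub, degree_sub_eq_left_of_degree_lt]
        · simp [hp.ne_zero]
        · refine (degree_X_add_C x).trans_lt ?_
          rw [degree_X_pow]
          exact_mod_cast hp.one_lt)
    have hβ' : β ^ p - β = x := by
      simpa [sub_eq_zero, IntermediateField.algebraMap_apply] using hβ
    have hmem := mem_maxSolvableExt_of_pow_sub_mem hL (p := p) (β := β)
      (by rw [hβ']; exact fun h0 ↦ hx (Subtype.ext h0)) (by rw [hβ']; exact x.2)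
    exact ⟨⟨β, hmem⟩, Subtype.ext hβ'⟩
  · have : NeZero (p : AlgebraicClosure K) := ⟨by
      rw [← map_natCast (algebraMap K _)]
      exact (_root_.map_ne_zero _).2 hpK⟩
    obtain ⟨ζ, hζ⟩ := HasEnoughRootsOfUnity.exists_primitiveRoot (AlgebraicClosure K) p
    have hζL := mem_maxSolvableExt_of_pow_eq_one hpK hζ.pow_eq_one
    refine finrank_ne_of_primitiveRoot hi (ζ := ⟨ζ, hζL⟩)
      (IsPrimitiveRoot.coe_submonoidClass_iff.1 hζ) fun x ↦ ?_
    obtain ⟨β, hβ⟩ := IsAlgClosed.exists_pow_nat_eq (x : AlgebraicClosure K) hp.pos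
    exact ⟨⟨β, mem_maxSolvableExt_of_pow_mem hL hpK (hβ ▸ x.2)⟩, Subtype.ext hβ⟩

theorem exists_sq_eq_neg_one (K : Type*) [Field K] : ∃ i : solvClosure K, i ^ 2 = -1 := by
  by_cases h2 : (2 : K) = 0
  · refine ⟨1, ?_⟩
    have h3 : (2 : solvClosure K) = 0 := by
      rw [← map_ofNat (algebraMap K (solvClosure K)), h2, map_zero]
    linear_combination h3
  · obtain ⟨i, hi⟩ := IsAlgClosed.exists_pow_nat_eq (-1 : AlgebraicClosure K) two_pos
    have h4 : ((4 : ℕ) : K) ≠ 0 := by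
      have : ((4 : ℕ) : K) = 2 * 2 := by norm_num
      rw [this]
      exact mul_ne_zero h2 h2
    exact ⟨⟨i, mem_maxSolvableExt_of_pow_eq_one h4 (by linear_combination (i ^ 2 - 1) * hi)⟩,
      Subtype.ext hi⟩

end SolvClosure

open IntermediateField Polynomial SolvClosure

/-- If `K^solv` is a finite extension of `K`, then `[K^solv : K] ≤ 2`. -/
theorem statement_10 (K : Type) [Field K] (h : FiniteDimensional K ↥(solvClosure K)) :
    Module.finrank K ↥(solvClosure K) ≤ 2 := by
  have := (isSolvGalois_maxSolvableExt h).2.1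
  obtain ⟨i, hi⟩ := exists_sq_eq_neg_one K
  have hint : IsIntegral K i := IsIntegral.of_finite K i
  suffices hbot : K⟮i⟯.fixingSubgroup = ⊥ by
    have htop : K⟮i⟯ = ⊤ := by
      rw [← IsGalois.fixedField_fixingSubgroup K⟮i⟯, hbot, fixedField_bot]
    rw [← finrank_top', ← htop, adjoin.finrank hint]
    have hq : (X ^ 2 + C 1 : K[X]) ≠ 0 := (monic_X_pow_add_C 1 two_ne_zero).ne_zero
    have hdvd : minpoly K i ∣ X ^ 2 + C 1 := minpoly.dvd K i (by simp [hi])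
    exact (natDegree_le_of_dvd hdvd hq).trans_eq natDegree_X_pow_add_C
  by_contra hbot
  have hcard : Nat.card K⟮i⟯.fixingSubgroup ≠ 1 := fun hc ↦ hbot (Subgroup.card_eq_one.1 hc)
  obtain ⟨p, hp, hdvd⟩ := Nat.exists_prime_and_dvd hcard
  have : Fact p.Prime := ⟨hp⟩
  obtain ⟨σ, hσ⟩ := exists_prime_orderOf_dvd_card' p hdvd
  have hiF : i ∈ fixedField (Subgroup.zpowers (σ : Gal(solvClosure K/K))) := by
    have hle : K⟮i⟯ ≤ fixedField (Subgroup.zpowers (σ : Gal(solvClosure K/K))) := by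
      rw [le_iff_le, Subgroup.zpowers_le]
      exact σ.2
    exact hle (mem_adjoin_simple_self K i)
  refine finrank_ne_prime h
    (F := fixedField (Subgroup.zpowers (σ : Gal(solvClosure K/K)))) (i := ⟨i, hiF⟩)
    (Subtype.ext hi) hp ?_
  rw [finrank_fixedField_eq_card, Nat.card_zpowers, Subgroup.orderOf_coe, hσ]
end
end
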